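/- The subgraph induced in Λ(2) by the lattice pentagons (lattice polygons with exactly 5 vertices) and the lattice hexagons (lattice polygons with exactly 6 vertices) is connected. -/

import Mathlib

open Set

/-- Points of `ℝ^d`. -/
abbrev Pt (d : ℕ) := Fin d → ℝ

/-- A polytope in `ℝ^d` is the convex hull of a finite set of points. -/
def IsPolytope (d : ℕ) (P : Set (Pt d)) : Prop :=
  ∃ S : Finset (Pt d), P = convexHull ℝ (S : Set (Pt d))

/-- A set is `d`-dimensional (full-dimensional) if its affine hull is all of `ℝ^d`. -/
def FullDim (d : ℕ) (P : Set (Pt d)) : Prop := affineSpan ℝ P = ⊤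

/-- A point `x` can be inserted in `P` when the convex hull of `P ∪ {x}` has as its
vertex set (set of extreme points) exactly the vertex set of `P` together with `x`. -/
def CanInsert (d : ℕ) (P : Set (Pt d)) (x : Pt d) : Prop :=
  Set.extremePoints ℝ (convexHull ℝ (P ∪ {x})) = Set.extremePoints ℝ P ∪ {x}

/-- A vertex `v` of `P` can be deleted from `P` when the convex hull of the remaining
vertices is `d`-dimensional. -/
def CanDelete (d : ℕ) (P : Set (Pt d)) (v : Pt d) : Prop :=
  v ∈ Set.extremePoints ℝ P ∧
    FullDim d (convexHull ℝ (Set.extremePoints ℝ P \ {v}))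

/-- `Q` is obtained from `P` by an insertion move. -/
def InsertMove (d : ℕ) (P Q : Set (Pt d)) : Prop :=
  ∃ x : Pt d, CanInsert d P x ∧ Q = convexHull ℝ (P ∪ {x})

/-- `Q` is obtained from `P` by a deletion move. -/
def DeleteMove (d : ℕ) (P Q : Set (Pt d)) : Prop :=
  ∃ v : Pt d, CanDelete d P v ∧ Q = convexHull ℝ (Set.extremePoints ℝ P \ {v})

/-- Adjacency: one polytope is obtained from the other by inserting a point or
deleting a vertex. -/
def Move (d : ℕ) (P Q : Set (Pt d)) : Prop :=
  InsertMove d P Q ∨ DeleteMove d P Q ∨ InsertMove d Q P ∨ DeleteMove d Q P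

/-- There is a path of at most `n` edges from `P` to `Q` all of whose vertices lie in
the class `C` of polytopes (i.e. `P` and `Q` are at distance at most `n` in the subgraph
induced by `C`). -/
def PathLE (d : ℕ) (C : Set (Set (Pt d))) (P Q : Set (Pt d)) (n : ℕ) : Prop :=
  ∃ (m : ℕ) (f : ℕ → Set (Pt d)), m ≤ n ∧ f 0 = P ∧ f m = Q ∧
    (∀ i ≤ m, f i ∈ C) ∧ ∀ i < m, Move d (f i) (f (i + 1))

/-- The subgraph induced by the class `C` is connected. -/
def ConnectedIn (d : ℕ) (C : Set (Set (Pt d))) : Prop :=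
  ∀ P ∈ C, ∀ Q ∈ C, ∃ n, PathLE d C P Q n

/-- The vertex set of the graph `Γ(d)`: the `d`-dimensional polytopes in `ℝ^d`. -/
def Gamma (d : ℕ) : Set (Set (Pt d)) := {P | IsPolytope d P ∧ FullDim d P}

/-- The number of vertices of a polytope. -/
noncomputable def nVerts (d : ℕ) (P : Set (Pt d)) : ℕ := (Set.extremePoints ℝ P).ncard

/-- A lattice point of `ℝ^d`. -/
def IsLatticePt (d : ℕ) (x : Pt d) : Prop := ∀ i, ∃ z : ℤ, x i = (z : ℝ)

/-- A lattice polytope: all its vertices are lattice points. -/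
def IsLatticePoly (d : ℕ) (P : Set (Pt d)) : Prop :=
  ∀ v ∈ Set.extremePoints ℝ P, IsLatticePt d v

/-- The hypercube `[0,k]^d`. -/
def Cube (d k : ℕ) : Set (Pt d) := {x | ∀ i, x i ∈ Set.Icc (0 : ℝ) (k : ℝ)}

/-- The vertex set of `Λ(d)`: the `d`-dimensional lattice polytopes in `ℝ^d`. -/
def Lambda (d : ℕ) : Set (Set (Pt d)) :=
  {P | IsPolytope d P ∧ FullDim d P ∧ IsLatticePoly d P}

/-- The vertex set of `Λ(d,k)`: the `d`-dimensional lattice polytopes in `[0,k]^d`. -/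
def LambdaK (d k : ℕ) : Set (Set (Pt d)) := {P ∈ Lambda d | P ⊆ Cube d k}

/-- A facet of a polytope `P`: an exposed face of dimension `d-1`. -/
def IsFacet (d : ℕ) (P F : Set (Pt d)) : Prop :=
  IsExposed ℝ P F ∧ F.Nonempty ∧ F ≠ P ∧
    Module.finrank ℝ ↥(vectorSpan ℝ F) = d - 1

/-- `H` is the closed half-space `H_F^-(P)` bounded by the affine hull of the facet `F`
and satisfying `P ∩ H = F`. -/
def BoundingHalfspace (d : ℕ) (P F H : Set (Pt d)) : Prop :=
  ∃ (l : (Pt d) →ₗ[ℝ] ℝ) (c : ℝ), l ≠ 0 ∧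
    H = {x | l x ≤ c} ∧
    (affineSpan ℝ F : Set (Pt d)) = {x | l x = c} ∧
    P ∩ H = F

/-- The cone `C_v(P)`: the intersection of the half-spaces `H_F^-(P)` over all facets
`F` of `P` incident to `v`. -/
def Cone (d : ℕ) (P : Set (Pt d)) (v : Pt d) : Set (Pt d) :=
  {x | ∀ F H : Set (Pt d), IsFacet d P F → v ∈ F → BoundingHalfspace d P F H → x ∈ H}

/-- A set `A` is in convex position: every finite subset of `A` is the vertex set of
a polytope, namely of its own convex hull. -/
def ConvexPosition (d : ℕ) (A : Set (Pt d)) : Prop :=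
  ∀ S : Finset (Pt d), (S : Set (Pt d)) ⊆ A →
    Set.extremePoints ℝ (convexHull ℝ (S : Set (Pt d))) = (S : Set (Pt d))

/-- Twice the signed area of the triangle `p q r`; it is positive exactly when the triangle
is oriented counterclockwise. -/
def orient (p q r : ℤ × ℤ) : ℤ :=
  (q.1 - p.1) * (r.2 - p.2) - (q.2 - p.2) * (r.1 - p.1)

theorem orient_rotate (p q r : ℤ × ℤ) : orient q r p = orient p q r := by
  simp only [orient]; ring

/-- The points `a b c d e` are, in counterclockwise order, the vertices of a convex pentagon. -/
structure Pent (a b c d e : ℤ × ℤ) : Prop where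
  abc : 0 < orient a b c
  abd : 0 < orient a b d
  abe : 0 < orient a b e
  acd : 0 < orient a c d
  ace : 0 < orient a c e
  ade : 0 < orient a d e
  bcd : 0 < orient b c d
  bce : 0 < orient b c e
  bde : 0 < orient b d e
  cde : 0 < orient c d e

/-- The points `a b c d e f` are, in counterclockwise order, the vertices of a convex hexagon. -/
structure Hex (a b c d e f : ℤ × ℤ) : Prop where
  pent : Pent a b c d e
  abf : 0 < orient a b f
  acf : 0 < orient a c f
  adf : 0 < orient a d f
  aef : 0 < orient a e f
  bcf : 0 < orient b c f
  bdf : 0 < orient b d f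
  bef : 0 < orient b e f
  cdf : 0 < orient c d f
  cef : 0 < orient c e f
  def' : 0 < orient d e f

theorem Pent.rotate {a b c d e : ℤ × ℤ} (h : Pent a b c d e) : Pent b c d e a where
  abc := h.bcd
  abd := h.bce
  abe := orient_rotate a b c ▸ h.abc
  acd := h.bde
  ace := orient_rotate a b d ▸ h.abd
  ade := orient_rotate a b e ▸ h.abe
  bcd := h.cde
  bce := orient_rotate a c d ▸ h.acd
  bde := orient_rotate a c e ▸ h.ace
  cde := orient_rotate a d e ▸ h.ade

theorem Hex.rotate {a b c d e f : ℤ × ℤ} (h : Hex a b c d e f) : Hex b c d e f a where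
  pent := ⟨h.pent.bcd, h.pent.bce, h.bcf, h.pent.bde, h.bdf, h.bef, h.pent.cde, h.cdf, h.cef,
    h.def'⟩
  abf := orient_rotate a b c ▸ h.pent.abc
  acf := orient_rotate a b d ▸ h.pent.abd
  adf := orient_rotate a b e ▸ h.pent.abe
  aef := orient_rotate a b f ▸ h.abf
  bcf := orient_rotate a c d ▸ h.pent.acd
  bdf := orient_rotate a c e ▸ h.pent.ace
  bef := orient_rotate a c f ▸ h.acf
  cdf := orient_rotate a d e ▸ h.pent.ade
  cef := orient_rotate a d f ▸ h.adf
  def' := orient_rotate a e f ▸ h.aef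

theorem orient_plucker (p x y z w : ℤ × ℤ) :
    orient p x z * orient p y w = orient p x y * orient p z w + orient p x w * orient p y z := by
  simp only [orient]; ring

theorem orient_pos_of_outer {p x y z w : ℤ × ℤ} (hyw : 0 < orient p y w) (hxy : 0 < orient p x y)
    (hzw : 0 < orient p z w) (hxw : 0 < orient p x w) (hyz : 0 < orient p y z) :
    0 < orient p x z := by
  have h := orient_plucker p x y z w
  have : 0 < orient p x z * orient p y w := by rw [h]; positivity
  exact pos_of_mul_pos_left this hyw.le

theorem orient_pos_of_inner {p x y z w : ℤ × ℤ} (hxz : 0 < orient p x z) (hxy : 0 < orient p x y)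
    (hzw : 0 < orient p z w) (hxw : 0 < orient p x w) (hyz : 0 < orient p y z) :
    0 < orient p y w := by
  have h := orient_plucker p x y z w
  have : 0 < orient p x z * orient p y w := by rw [h]; positivity
  exact pos_of_mul_pos_right this hxz.le

theorem orient_pos_rotate {p q r : ℤ × ℤ} (h : 0 < orient p q r) : 0 < orient q r p :=
  orient_rotate p q r ▸ h

theorem orient_pos_rotate' {p q r : ℤ × ℤ} (h : 0 < orient p q r) : 0 < orient r p q :=
  orient_pos_rotate (orient_pos_rotate h)

/-- A point beyond the edge `ab` of a convex pentagon, on the inner side of the two neighboring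
edges, extends it to a convex hexagon. -/
theorem Pent.insert {a b c d e z : ℤ × ℤ} (h : Pent a b c d e) (hea : 0 < orient e a z)
    (hab : 0 < orient a z b) (hbc : 0 < orient b c z) : Hex a z b c d e := by
  have aze : 0 < orient a z e := orient_pos_rotate hea
  have azc : 0 < orient a z c := orient_pos_of_outer h.abe hab h.ace aze h.abc
  have azd : 0 < orient a z d := orient_pos_of_outer h.abe hab h.ade aze h.abd
  have baz : 0 < orient b a z := orient_pos_rotate' hab
  have bca : 0 < orient b c a := orient_pos_rotate h.abc
  have bda : 0 < orient b d a := orient_pos_rotate h.abd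
  have bea : 0 < orient b e a := orient_pos_rotate h.abe
  have bdz : 0 < orient b d z := orient_pos_of_inner bca h.bcd baz hbc bda
  have bez : 0 < orient b e z := orient_pos_of_inner bca h.bce baz hbc bea
  have cab : 0 < orient c a b := orient_pos_rotate' h.abc
  have caz : 0 < orient c a z := orient_pos_rotate' azc
  have czb : 0 < orient c z b := orient_pos_rotate hbc
  have cdz : 0 < orient c d z :=
    orient_pos_of_outer cab (orient_pos_rotate h.acd) czb (orient_pos_rotate h.bcd) caz
  have cez : 0 < orient c e z :=
    orient_pos_of_outer cab (orient_pos_rotate h.ace) czb (orient_pos_rotate h.bce) caz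
  have dez : 0 < orient d e z :=
    orient_pos_of_outer (orient_pos_rotate' h.abd) (orient_pos_rotate h.ade)
      (orient_pos_rotate bdz) (orient_pos_rotate h.bde) (orient_pos_rotate' azd)
  have ze : ∀ {x}, 0 < orient x e z → 0 < orient z x e := orient_pos_rotate'
  exact ⟨⟨hab, azc, azd, h.abc, h.abd, h.acd, orient_pos_rotate' hbc, orient_pos_rotate' bdz,
    orient_pos_rotate' cdz, h.bcd⟩, aze, h.abe, h.ace, h.ade, ze bez, ze cez, ze dez,
    h.bce, h.bde, h.cde⟩

/-- The set of the five given points. -/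
def fivePts (a b c d e : ℤ × ℤ) : Finset (ℤ × ℤ) := {a, b, c, d, e}

theorem fivePts_rotate (a b c d e : ℤ × ℤ) : fivePts b c d e a = fivePts a b c d e := by
  ext x; simp only [fivePts, Finset.mem_insert, Finset.mem_singleton]; tauto

theorem fivePts_reverse (a b c d e : ℤ × ℤ) : fivePts e d c b a = fivePts a b c d e := by
  ext x; simp only [fivePts, Finset.mem_insert, Finset.mem_singleton]; tauto

/-- Two pentagons are linked when they arise from a hexagon by deleting two consecutive
vertices. -/
def Link (S T : Finset (ℤ × ℤ)) : Prop :=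
  ∃ a b c d e f, Hex a b c d e f ∧ S = fivePts a b c d e ∧ T = fivePts b c d e f

/-- Two pentagons are joined when they are related by a chain of links. -/
def PentJoined (S T : Finset (ℤ × ℤ)) : Prop := Relation.EqvGen Link S T

theorem PentJoined.refl (S : Finset (ℤ × ℤ)) : PentJoined S S := Relation.EqvGen.refl S

theorem PentJoined.symm {S T : Finset (ℤ × ℤ)} (h : PentJoined S T) : PentJoined T S :=
  Relation.EqvGen.symm _ _ h

theorem PentJoined.trans {S T U : Finset (ℤ × ℤ)} (h : PentJoined S T) (h' : PentJoined T U) :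
    PentJoined S U :=
  Relation.EqvGen.trans _ _ _ h h'

theorem PentJoined.of_link {S T : Finset (ℤ × ℤ)} (h : Link S T) : PentJoined S T :=
  Relation.EqvGen.rel _ _ h

theorem Hex.joined_last {a b c d e f : ℤ × ℤ} (h : Hex a b c d e f) :
    ∀ S ∈ [fivePts b c d e f, fivePts a c d e f, fivePts a b d e f, fivePts a b c e f,
      fivePts a b c d f, fivePts a b c d e], PentJoined S (fivePts a b c d e) := by
  have key : ∀ {a b c d e f}, Hex a b c d e f →
      PentJoined (fivePts b c d e f) (fivePts a b c d e) := fun {a b c d e f} h =>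
    (PentJoined.of_link ⟨a, b, c, d, e, f, h, rfl, rfl⟩).symm
  have h1 := key h
  have h2 := (key h.rotate).trans h1
  have h3 := (key h.rotate.rotate).trans h2
  have h4 := (key h.rotate.rotate.rotate).trans h3
  have h5 := (key h.rotate.rotate.rotate.rotate).trans h4
  simp only [List.mem_cons, List.not_mem_nil, or_false]
  rintro S (rfl | rfl | rfl | rfl | rfl | rfl)
  · exact h1
  · rwa [← fivePts_rotate]
  · rwa [← fivePts_rotate, ← fivePts_rotate]
  · rwa [← fivePts_rotate, ← fivePts_rotate, ← fivePts_rotate]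
  · rwa [← fivePts_rotate, ← fivePts_rotate, ← fivePts_rotate, ← fivePts_rotate]
  · exact PentJoined.refl _

/-- Any two pentagons obtained from the same hexagon by deleting a vertex are joined. -/
theorem Hex.joined {a b c d e f : ℤ × ℤ} (h : Hex a b c d e f) {S T : Finset (ℤ × ℤ)}
    (hS : S ∈ [fivePts b c d e f, fivePts a c d e f, fivePts a b d e f, fivePts a b c e f,
      fivePts a b c d f, fivePts a b c d e])
    (hT : T ∈ [fivePts b c d e f, fivePts a c d e f, fivePts a b d e f, fivePts a b c e f,
      fivePts a b c d f, fivePts a b c d e]) : PentJoined S T :=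
  (h.joined_last S hS).trans (h.joined_last T hT).symm

theorem Hex.map {a b c d e f : ℤ × ℤ} (h : Hex a b c d e f) {g : ℤ × ℤ → ℤ × ℤ}
    (hg : ∀ p q r, orient (g p) (g q) (g r) = orient p q r) :
    Hex (g a) (g b) (g c) (g d) (g e) (g f) := by
  obtain ⟨⟨h1, h2, h3, h4, h5, h6, h7, h8, h9, h10⟩, h11, h12, h13, h14, h15, h16, h17, h18, h19,
    h20⟩ := h
  constructor <;> [constructor; skip; skip; skip; skip; skip; skip; skip; skip; skip; skip] <;>
    rwa [hg]

theorem Pent.map {a b c d e : ℤ × ℤ} (h : Pent a b c d e) {g : ℤ × ℤ → ℤ × ℤ}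
    (hg : ∀ p q r, orient (g p) (g q) (g r) = orient p q r) :
    Pent (g a) (g b) (g c) (g d) (g e) := by
  obtain ⟨h1, h2, h3, h4, h5, h6, h7, h8, h9, h10⟩ := h
  constructor <;> rwa [hg]

theorem fivePts_image (g : ℤ × ℤ → ℤ × ℤ) (a b c d e : ℤ × ℤ) :
    (fivePts a b c d e).image g = fivePts (g a) (g b) (g c) (g d) (g e) := by
  simp [fivePts, Finset.image_insert]

theorem PentJoined.image_of_link {g : ℤ × ℤ → ℤ × ℤ}
    (hg : ∀ {S T}, Link S T → PentJoined (S.image g) (T.image g)) {S T : Finset (ℤ × ℤ)}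
    (h : PentJoined S T) : PentJoined (S.image g) (T.image g) := by
  induction h with
  | rel _ _ h => exact hg h
  | refl _ => exact PentJoined.refl _
  | symm _ _ _ ih => exact ih.symm
  | trans _ _ _ _ _ ih ih' => exact ih.trans ih'

theorem PentJoined.image {g : ℤ × ℤ → ℤ × ℤ}
    (hg : ∀ p q r, orient (g p) (g q) (g r) = orient p q r) {S T : Finset (ℤ × ℤ)}
    (h : PentJoined S T) : PentJoined (S.image g) (T.image g) := by
  refine PentJoined.image_of_link ?_ h
  rintro _ _ ⟨a, b, c, d, e, f, h, rfl, rfl⟩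
  simp only [fivePts_image]
  exact PentJoined.of_link ⟨_, _, _, _, _, _, h.map hg, rfl, rfl⟩

theorem orient_swap (p q r : ℤ × ℤ) : orient r.swap q.swap p.swap = orient p q r := by
  simp only [orient, Prod.fst_swap, Prod.snd_swap]; ring

theorem Pent.swap {a b c d e : ℤ × ℤ} (h : Pent a b c d e) :
    Pent e.swap d.swap c.swap b.swap a.swap := by
  obtain ⟨h1, h2, h3, h4, h5, h6, h7, h8, h9, h10⟩ := h
  constructor <;> rwa [orient_swap]

theorem Hex.swap {a b c d e f : ℤ × ℤ} (h : Hex a b c d e f) :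
    Hex f.swap e.swap d.swap c.swap b.swap a.swap := by
  obtain ⟨⟨h1, h2, h3, h4, h5, h6, h7, h8, h9, h10⟩, h11, h12, h13, h14, h15, h16, h17, h18, h19,
    h20⟩ := h
  constructor <;> [constructor; skip; skip; skip; skip; skip; skip; skip; skip; skip; skip] <;>
    rwa [orient_swap]

theorem PentJoined.image_swap {S T : Finset (ℤ × ℤ)} (h : PentJoined S T) :
    PentJoined (S.image Prod.swap) (T.image Prod.swap) := by
  refine PentJoined.image_of_link ?_ h
  rintro _ _ ⟨a, b, c, d, e, f, h, rfl, rfl⟩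
  simp only [fivePts_image]
  rw [← fivePts_reverse, ← fivePts_reverse b.swap]
  exact (PentJoined.of_link ⟨_, _, _, _, _, _, h.swap, rfl, rfl⟩).symm

/-- A lattice pentagon of least area, to which every other one is to be joined. -/
def basePent : Finset (ℤ × ℤ) := fivePts (1, 0) (2, 1) (1, 2) (0, 1) (0, 0)

theorem basePent_swap : basePent.image Prod.swap = basePent := by decide

theorem hex_iff (a b c d e f : ℤ × ℤ) : Hex a b c d e f ↔
    (0 < orient a b c ∧ 0 < orient a b d ∧ 0 < orient a b e ∧ 0 < orient a c d ∧
      0 < orient a c e ∧ 0 < orient a d e ∧ 0 < orient b c d ∧ 0 < orient b c e ∧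
      0 < orient b d e ∧ 0 < orient c d e) ∧
    0 < orient a b f ∧ 0 < orient a c f ∧ 0 < orient a d f ∧ 0 < orient a e f ∧
      0 < orient b c f ∧ 0 < orient b d f ∧ 0 < orient b e f ∧ 0 < orient c d f ∧
      0 < orient c e f ∧ 0 < orient d e f :=
  ⟨fun ⟨⟨h1, h2, h3, h4, h5, h6, h7, h8, h9, h10⟩, k1, k2, k3, k4, k5, k6, k7, k8, k9, k10⟩ =>
      ⟨⟨h1, h2, h3, h4, h5, h6, h7, h8, h9, h10⟩, k1, k2, k3, k4, k5, k6, k7, k8, k9, k10⟩,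
    fun ⟨⟨h1, h2, h3, h4, h5, h6, h7, h8, h9, h10⟩, k1, k2, k3, k4, k5, k6, k7, k8, k9, k10⟩ =>
      ⟨⟨h1, h2, h3, h4, h5, h6, h7, h8, h9, h10⟩, k1, k2, k3, k4, k5, k6, k7, k8, k9, k10⟩⟩

instance (a b c d e f : ℤ × ℤ) : Decidable (Hex a b c d e f) :=
  decidable_of_iff' _ (hex_iff a b c d e f)

theorem basePent_joined_add : PentJoined (basePent.image (· + (1, 0))) basePent := by
  have h1 : Hex (1, 0) (2, 0) (3, 1) (3, 2) (2, 2) (1, 1) := by decide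
  have h2 : Hex (0, 1) (1, 0) (2, 0) (3, 1) (3, 2) (2, 2) := by decide
  have h3 : Hex (0, 0) (1, 0) (3, 1) (3, 2) (2, 2) (0, 1) := by decide
  have h4 : Hex (0, 0) (1, 0) (3, 1) (2, 2) (1, 2) (0, 1) := by decide
  have h5 : Hex (0, 0) (1, 0) (2, 1) (2, 2) (1, 2) (0, 1) := by decide
  exact (h1.joined (T := fivePts (1, 0) (2, 0) (3, 1) (3, 2) (2, 2))
      (by decide) (by decide)).trans <|
    (h2.joined (T := fivePts (0, 1) (1, 0) (3, 1) (3, 2) (2, 2))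
      (by decide) (by decide)).trans <|
    (h3.joined (T := fivePts (0, 0) (1, 0) (3, 1) (2, 2) (0, 1))
      (by decide) (by decide)).trans <|
    (h4.joined (T := fivePts (0, 0) (1, 0) (2, 2) (1, 2) (0, 1))
      (by decide) (by decide)).trans <|
    h5.joined (by decide) (by decide)

theorem basePent_joined_quarter_turn :
    PentJoined (basePent.image fun p => (-p.2, p.1)) basePent := by
  have h1 : Hex (-2, 1) (-1, 0) (0, 0) (0, 1) (-1, 2) (-2, 2) := by decide
  have h2 : Hex (-2, 1) (-1, 0) (0, 0) (2, 1) (-1, 2) (-2, 2) := by decide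
  have h3 : Hex (-2, 1) (0, 0) (1, 0) (2, 1) (-1, 2) (-2, 2) := by decide
  have h4 : Hex (-2, 1) (0, 0) (1, 0) (2, 1) (1, 2) (-1, 2) := by decide
  have h5 : Hex (-2, 1) (0, 0) (1, 0) (2, 1) (2, 2) (1, 2) := by decide
  have h6 : Hex (0, 0) (1, 0) (2, 1) (2, 2) (1, 2) (0, 1) := by decide
  exact (h1.joined (T := fivePts (-2, 1) (-1, 0) (0, 0) (-1, 2) (-2, 2))
      (by decide) (by decide)).trans <|
    (h2.joined (T := fivePts (-2, 1) (0, 0) (2, 1) (-1, 2) (-2, 2))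
      (by decide) (by decide)).trans <|
    (h3.joined (T := fivePts (-2, 1) (0, 0) (1, 0) (2, 1) (-1, 2))
      (by decide) (by decide)).trans <|
    (h4.joined (T := fivePts (-2, 1) (0, 0) (1, 0) (2, 1) (1, 2))
      (by decide) (by decide)).trans <|
    (h5.joined (T := fivePts (0, 0) (1, 0) (2, 1) (2, 2) (1, 2))
      (by decide) (by decide)).trans <|
    h6.joined (by decide) (by decide)

theorem basePent_joined_shear :
    PentJoined (basePent.image fun p => (p.1 + p.2, p.2)) basePent := by
  have h1 : Hex (0, 0) (1, 0) (3, 1) (4, 2) (3, 2) (1, 1) := by decide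
  have h2 : Hex (0, 0) (1, 0) (3, 1) (4, 2) (3, 2) (0, 1) := by decide
  have h3 : Hex (0, 0) (1, 0) (3, 1) (3, 2) (1, 2) (0, 1) := by decide
  have h4 : Hex (0, 0) (1, 0) (3, 2) (3, 3) (1, 2) (0, 1) := by decide
  have h5 : Hex (0, 0) (1, 0) (2, 1) (3, 3) (1, 2) (0, 1) := by decide
  exact (h1.joined (T := fivePts (0, 0) (1, 0) (3, 1) (4, 2) (3, 2))
      (by decide) (by decide)).trans <|
    (h2.joined (T := fivePts (0, 0) (1, 0) (3, 1) (3, 2) (0, 1))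
      (by decide) (by decide)).trans <|
    (h3.joined (T := fivePts (0, 0) (1, 0) (3, 2) (1, 2) (0, 1))
      (by decide) (by decide)).trans <|
    (h4.joined (T := fivePts (0, 0) (1, 0) (3, 3) (1, 2) (0, 1))
      (by decide) (by decide)).trans <|
    h5.joined (by decide) (by decide)

theorem house_joined : PentJoined (fivePts (0, 0) (2, 0) (2, 1) (1, 2) (0, 1)) basePent := by
  have h1 : Hex (0, 0) (1, -2) (2, 0) (2, 1) (1, 2) (0, 1) := by decide
  have h2 : Hex (0, 0) (1, -2) (2, 1) (2, 2) (1, 2) (0, 1) := by decide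
  have h3 : Hex (0, 0) (1, 0) (2, 1) (2, 2) (1, 2) (0, 1) := by decide
  exact (h1.joined (T := fivePts (0, 0) (1, -2) (2, 1) (1, 2) (0, 1))
      (by decide) (by decide)).trans <|
    (h2.joined (T := fivePts (0, 0) (2, 1) (2, 2) (1, 2) (0, 1))
      (by decide) (by decide)).trans <|
    h3.joined (by decide) (by decide)

theorem basePent_joined_translate (v : ℤ × ℤ) :
    PentJoined (basePent.image (· + v)) basePent := by
  have hor : ∀ v p q r : ℤ × ℤ, orient (p + v) (q + v) (r + v) = orient p q r := fun v p q r => by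
    simp only [orient, Prod.fst_add, Prod.snd_add]; ring
  have hadd : ∀ {v w}, PentJoined (basePent.image (· + v)) basePent →
      PentJoined (basePent.image (· + w)) basePent →
      PentJoined (basePent.image (· + (v + w))) basePent := fun {v w} hv hw => by
    refine PentJoined.trans ?_ hw
    have := hv.image (hor w)
    rwa [Finset.image_image, show (fun x : ℤ × ℤ => x + w) ∘ (fun x => x + v) =
      (fun x => x + (v + w)) from funext fun x => add_assoc x v w] at this
  have hneg : ∀ {v}, PentJoined (basePent.image (· + v)) basePent →
      PentJoined (basePent.image (· + -v)) basePent := fun {v} hv => by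
    have := (hv.image (hor (-v))).symm
    rwa [Finset.image_image, show (fun x : ℤ × ℤ => x + -v) ∘ (fun x => x + v) = id from
      funext fun x => add_neg_cancel_right x v, Finset.image_id] at this
  let G : AddSubgroup (ℤ × ℤ) :=
    { carrier := {v | PentJoined (basePent.image (· + v)) basePent}
      zero_mem' := by
        simpa only [Set.mem_ofPred_eq, add_zero, Finset.image_id'] using PentJoined.refl basePent
      add_mem' := hadd
      neg_mem' := hneg }
  have h1 : ((1, 0) : ℤ × ℤ) ∈ G := basePent_joined_add
  have h2 : ((0, 1) : ℤ × ℤ) ∈ G := by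
    have := basePent_joined_add.image_swap
    rw [basePent_swap, Finset.image_image] at this
    have h : basePent.image (Prod.swap ∘ fun x => x + (1, 0)) = basePent.image (· + (0, 1)) := by
      decide
    rwa [h] at this
  have : v = v.1 • (1, 0) + v.2 • (0, 1) := by ext <;> simp
  rw [this]
  exact G.add_mem (G.zsmul_mem h1 _) (G.zsmul_mem h2 _)

/-- The linear action of a unimodular matrix on the plane. -/
def act (M : Matrix.SpecialLinearGroup (Fin 2) ℤ) (p : ℤ × ℤ) : ℤ × ℤ :=
  (M 0 0 * p.1 + M 0 1 * p.2, M 1 0 * p.1 + M 1 1 * p.2)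

theorem orient_act (M : Matrix.SpecialLinearGroup (Fin 2) ℤ) (p q r : ℤ × ℤ) :
    orient (act M p) (act M q) (act M r) = orient p q r := by
  have h : M 0 0 * M 1 1 - M 0 1 * M 1 0 = 1 := by
    have := M.det_coe; rwa [Matrix.det_fin_two] at this
  simp only [orient, act]
  linear_combination ((q.1 - p.1) * (r.2 - p.2) - (q.2 - p.2) * (r.1 - p.1)) * h

theorem act_mul (M N : Matrix.SpecialLinearGroup (Fin 2) ℤ) : act (M * N) = act M ∘ act N := by
  funext p
  simp only [act, Function.comp, Matrix.SpecialLinearGroup.coe_mul, Matrix.mul_apply,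
    Fin.sum_univ_two]
  ext <;> simp only <;> ring

theorem act_one : act 1 = id := by
  funext p; simp [act]

theorem basePent_joined_act (M : Matrix.SpecialLinearGroup (Fin 2) ℤ) :
    PentJoined (basePent.image (act M)) basePent := by
  let G : Subgroup (Matrix.SpecialLinearGroup (Fin 2) ℤ) :=
    { carrier := {M | PentJoined (basePent.image (act M)) basePent}
      one_mem' := by simpa [act_one] using PentJoined.refl basePent
      mul_mem' := fun {M N} hM hN => by
        have h := hN.image (orient_act M)
        rw [Finset.image_image, ← act_mul] at h
        exact h.trans hM
      inv_mem' := fun {M} hM => by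
        have h := (hM.image (orient_act M⁻¹)).symm
        rwa [Finset.image_image, ← act_mul, inv_mul_cancel, act_one, Finset.image_id] at h }
  have hG : G = ⊤ := by
    rw [eq_top_iff, ← SpecialLinearGroup.SL2Z_generators, Subgroup.closure_le]
    rintro _ (rfl | rfl)
    · have h : act ModularGroup.S = fun p => (-p.2, p.1) := by
        funext p; simp [act, ModularGroup.S]
      change PentJoined (basePent.image (act _)) basePent
      rw [h]
      exact basePent_joined_quarter_turn
    · have h : act ModularGroup.T = fun p => (p.1 + p.2, p.2) := by
        funext p; simp [act, ModularGroup.T]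
      change PentJoined (basePent.image (act _)) basePent
      rw [h]
      exact basePent_joined_shear
  exact (hG ▸ Subgroup.mem_top M : M ∈ G)

/-- Twice the area of the pentagon `a b c d e`. -/
def area (a b c d e : ℤ × ℤ) : ℤ := orient a b c + orient a c d + orient a d e

/-- A pentagon of least area among those that are not joined to `basePent`. -/
structure MinBad (a b c d e : ℤ × ℤ) : Prop where
  pent : Pent a b c d e
  bad : ¬ PentJoined (fivePts a b c d e) basePent
  min : ∀ {a' b' c' d' e'}, Pent a' b' c' d' e' → area a' b' c' d' e' < area a b c d e →
    PentJoined (fivePts a' b' c' d' e') basePent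

theorem MinBad.rotate {a b c d e : ℤ × ℤ} (h : MinBad a b c d e) : MinBad b c d e a where
  pent := h.pent.rotate
  bad := by rw [fivePts_rotate]; exact h.bad
  min := fun hP hlt => h.min hP <| hlt.trans_eq <| by simp only [area, orient]; ring

theorem MinBad.map {a b c d e : ℤ × ℤ} (h : MinBad a b c d e) {g g' : ℤ × ℤ → ℤ × ℤ}
    (hg : ∀ p q r, orient (g p) (g q) (g r) = orient p q r) (hgg' : ∀ p, g (g' p) = p)
    (hg'g : ∀ p, g' (g p) = p) (hbase : PentJoined (basePent.image g) basePent) :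
    MinBad (g a) (g b) (g c) (g d) (g e) := by
  have hg' : ∀ p q r, orient (g' p) (g' q) (g' r) = orient p q r := fun p q r => by
    rw [← hg, hgg', hgg', hgg']
  refine ⟨h.pent.map hg, fun hj => h.bad ?_, fun {p q r s t} hP hlt => ?_⟩
  · have h1 := hj.image hg'
    have h2 := hbase.image hg'
    rw [fivePts_image, hg'g, hg'g, hg'g, hg'g, hg'g] at h1
    rw [Finset.image_image, show g' ∘ g = id from funext hg'g, Finset.image_id] at h2
    exact h1.trans h2.symm
  · have h1 := (h.min (hP.map hg') (by simpa only [area, hg, hg'] using hlt)).image hg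
    rw [fivePts_image, hgg', hgg', hgg', hgg', hgg'] at h1
    exact h1.trans hbase

theorem MinBad.linear {a b c d e : ℤ × ℤ} (h : MinBad a b c d e) {p q r s : ℤ}
    (hdet : p * s - q * r = 1) :
    MinBad (p * a.1 + q * a.2, r * a.1 + s * a.2) (p * b.1 + q * b.2, r * b.1 + s * b.2)
      (p * c.1 + q * c.2, r * c.1 + s * c.2) (p * d.1 + q * d.2, r * d.1 + s * d.2)
      (p * e.1 + q * e.2, r * e.1 + s * e.2) := by
  let M : Matrix.SpecialLinearGroup (Fin 2) ℤ := ⟨!![p, q; r, s], by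
    rw [Matrix.det_fin_two_of, hdet]⟩
  refine h.map (g := act M) (g' := act M⁻¹) (orient_act M) (fun x => ?_) (fun x => ?_)
    (basePent_joined_act M)
  · rw [← Function.comp_apply (f := act M), ← act_mul, mul_inv_cancel, act_one, id]
  · rw [← Function.comp_apply (f := act M⁻¹), ← act_mul, inv_mul_cancel, act_one, id]

theorem MinBad.translate {a b c d e : ℤ × ℤ} (h : MinBad a b c d e) (v : ℤ × ℤ) :
    MinBad (a + v) (b + v) (c + v) (d + v) (e + v) :=
  h.map (g := (· + v)) (g' := (· - v))
    (fun p q r => by simp only [orient, Prod.fst_add, Prod.snd_add]; ring)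
    (fun p => sub_add_cancel p v) (fun p => add_sub_cancel_right p v)
    (basePent_joined_translate v)

theorem area_swap (a b c d e : ℤ × ℤ) :
    area e.swap d.swap c.swap b.swap a.swap = area a b c d e := by
  simp only [area, orient, Prod.fst_swap, Prod.snd_swap]; ring

theorem MinBad.swap {a b c d e : ℤ × ℤ} (h : MinBad a b c d e) :
    MinBad e.swap d.swap c.swap b.swap a.swap := by
  refine ⟨h.pent.swap, fun hj => h.bad ?_, fun {p q r s t} hP hlt => ?_⟩
  · have h1 := hj.image_swap
    rwa [fivePts_image, basePent_swap, fivePts_reverse] at h1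
  · have h1 := (h.min hP.swap (by rw [area_swap]; rwa [area_swap] at hlt)).image_swap
    rwa [fivePts_image, Prod.swap_swap, Prod.swap_swap, Prod.swap_swap, Prod.swap_swap,
      Prod.swap_swap, fivePts_reverse, basePent_swap] at h1

/-- The mirror image in the vertical axis. -/
theorem MinBad.reflect {a b c d e : ℤ × ℤ} (h : MinBad a b c d e) :
    MinBad (-e.1, e.2) (-d.1, d.2) (-c.1, c.2) (-b.1, b.2) (-a.1, a.2) := by
  have := h.swap.linear (p := 0) (q := -1) (r := 1) (s := 0) (by norm_num)
  simpa using this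

/-- The point `z` lies beyond the edge `qr` of a convex polygon and on the inner side of the
neighboring edges `pq` and `rs`. -/
def Beyond (p q r s z : ℤ × ℤ) : Prop := 0 < orient p q z ∧ 0 < orient q z r ∧ 0 < orient r s z

theorem pos_of_mul_eq {x y z : ℤ} (hy : 0 < y) (h : x * y = z) (hz : 0 < z) : 0 < x :=
  pos_of_mul_pos_left (h ▸ hz) hy.le

/-- A vertex of a convex pentagon may be replaced by a point of the triangle that it spans with
its neighbors. -/
theorem Pent.replace {a b c d e a' : ℤ × ℤ} (h : Pent a b c d e) (h1 : 0 ≤ orient e a a')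
    (h2 : 0 ≤ orient a b a') (h3 : 0 < orient e a' b) : Pent a' b c d e := by
  have key : ∀ {p q}, 0 < orient a p q → 0 ≤ orient b p q → 0 ≤ orient e p q →
      0 < orient a' p q := fun {p q} ha hb he => by
    refine pos_of_mul_eq (orient_pos_rotate' h.abe)
      (z := orient a p q * orient e a' b + orient b p q * orient e a a' +
        orient e p q * orient a b a') (by simp only [orient]; ring) (by positivity)
  have hbb : ∀ q, orient b b q = 0 := fun q => by simp only [orient]; ring
  have hee : ∀ q, orient e q e = 0 := fun q => by simp only [orient]; ring
  exact ⟨key h.abc (hbb c).ge (orient_pos_rotate' h.bce).le,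
    key h.abd (hbb d).ge (orient_pos_rotate' h.bde).le, orient_pos_rotate h3,
    key h.acd h.bcd.le (orient_pos_rotate' h.cde).le, key h.ace h.bce.le (hee c).ge,
    key h.ade h.bde.le (hee d).ge, h.bcd, h.bce, h.bde, h.cde⟩

theorem Pent.joined_of_beyond_bc {a b c d e a' z : ℤ × ℤ} (h : Pent a b c d e)
    (h' : Pent a' b c d e) (hz : Beyond a b c d z) (hz' : Beyond a' b c d z) :
    PentJoined (fivePts a b c d e) (fivePts a' b c d e) := by
  have H := h.rotate.insert hz.1 hz.2.1 hz.2.2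
  have H' := h'.rotate.insert hz'.1 hz'.2.1 hz'.2.2
  rw [← fivePts_rotate a, ← fivePts_rotate a']
  exact (H.joined (T := fivePts b z c d e) (by simp) (by simp)).trans
    (H'.joined (by simp) (by simp))

theorem Pent.joined_of_beyond_cd {a b c d e a' z : ℤ × ℤ} (h : Pent a b c d e)
    (h' : Pent a' b c d e) (hz : Beyond b c d e z) :
    PentJoined (fivePts a b c d e) (fivePts a' b c d e) := by
  have H := h.rotate.rotate.insert hz.1 hz.2.1 hz.2.2
  have H' := h'.rotate.rotate.insert hz.1 hz.2.1 hz.2.2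
  rw [← fivePts_rotate a, ← fivePts_rotate a', ← fivePts_rotate b, ← fivePts_rotate b]
  exact (H.joined (T := fivePts c z d e b) (by simp) (by simp)).trans
    (H'.joined (by simp) (by simp))

theorem Pent.joined_of_beyond_de {a b c d e a' z : ℤ × ℤ} (h : Pent a b c d e)
    (h' : Pent a' b c d e) (hz : Beyond c d e a z) (hz' : Beyond c d e a' z) :
    PentJoined (fivePts a b c d e) (fivePts a' b c d e) := by
  have H := h.rotate.rotate.rotate.insert hz.1 hz.2.1 hz.2.2
  have H' := h'.rotate.rotate.rotate.insert hz'.1 hz'.2.1 hz'.2.2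
  rw [← fivePts_rotate a, ← fivePts_rotate a', ← fivePts_rotate b, ← fivePts_rotate b,
    ← fivePts_rotate c, ← fivePts_rotate c]
  exact (H.joined (T := fivePts d z e b c) (by simp) (by simp)).trans
    (H'.joined (by simp) (by simp))

theorem Pent.exists_beyond {a b c d e : ℤ × ℤ} (h : Pent a b c d e)
    (hcross : 0 ≤ (c.1 - b.1) * (d.2 - e.2) - (c.2 - b.2) * (d.1 - e.1)) :
    ∃ z, Beyond b c d e z := by
  obtain ⟨x, hx⟩ : ∃ x, x = (c.1 - b.1) * (d.2 - e.2) - (c.2 - b.2) * (d.1 - e.1) := ⟨_, rfl⟩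
  rw [← hx] at hcross
  have h1 := h.acd
  have hN := h.acd.le
  obtain ⟨N, hNeq⟩ : ∃ N, N = orient a c d := ⟨_, rfl⟩
  rw [← hNeq] at h1 hN
  refine ⟨(a.1 + N * ((c.1 - b.1) + (d.1 - e.1)), a.2 + N * ((c.2 - b.2) + (d.2 - e.2))),
    ?_, ?_, ?_⟩
  · have : 0 < orient a b c + N * x := by have := h.abc; positivity
    rw [hx] at this
    convert this using 1
    simp only [orient]; ring
  · have : 0 < N * (orient b c d - 1) + N * orient c d e := by
      have h2 := h.cde
      have h3 := mul_nonneg hN (show 0 ≤ orient b c d - 1 by have := h.bcd; omega)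
      positivity
    refine this.trans_eq ?_
    trans N * (orient b c d + orient c d e) - orient a c d
    · rw [← hNeq]; ring
    · simp only [orient]; ring
  · have : 0 < orient a d e + N * x := by have := h.ade; positivity
    rw [hx] at this
    convert this using 1
    simp only [orient]; ring

/-- If a smaller pentagon arises by moving `a` inside the triangle `e a b`, then no lattice
point lies beyond the edges `bc`, `cd` and `de`. -/
theorem MinBad.not_beyond {a b c d e a' : ℤ × ℤ} (h : MinBad a b c d e)
    (h1 : 0 ≤ orient e a a') (h2 : 0 ≤ orient a b a') (h3 : 0 < orient e a' b)
    (h4 : 0 < orient e a a' + orient a b a') (z : ℤ × ℤ) :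
    ¬ Beyond a b c d z ∧ ¬ Beyond b c d e z ∧ ¬ Beyond c d e a z := by
  have h' := h.pent.replace h1 h2 h3
  have hbase := h.min h' (by
    have : area a b c d e = area a' b c d e + (orient e a a' + orient a b a') := by
      simp only [area, orient]; ring
    omega)
  refine ⟨fun hz => ?_, fun hz => ?_, fun hz => ?_⟩
  · refine h.bad ((h.pent.joined_of_beyond_bc h' hz ⟨?_, hz.2⟩).trans hbase)
    have := hz.1
    have := hz.2.1
    have := orient_pos_rotate h'.abc
    refine pos_of_mul_eq h.pent.abc (z := orient b z c * orient a b a' +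
      orient a b z * orient b c a') (by simp only [orient]; ring) (by positivity)
  · exact h.bad ((h.pent.joined_of_beyond_cd h' hz).trans hbase)
  · refine h.bad ((h.pent.joined_of_beyond_de h' hz ⟨hz.1, hz.2.1, ?_⟩).trans hbase)
    have := hz.2.2
    have : 0 < orient e d z := orient_pos_rotate' hz.2.1
    have := orient_pos_rotate' h'.ade
    refine pos_of_mul_eq h.pent.ade (z := orient e a a' * orient e d z +
      orient e a z * orient e a' d) (by simp only [orient]; ring) (by positivity)

/-- The triangle spanned by three consecutive vertices of a bad pentagon of least area has no
interior lattice point. -/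
theorem MinBad.not_interior {a b c d e a' : ℤ × ℤ} (h : MinBad a b c d e)
    (h1 : 0 < orient e a a') (h2 : 0 < orient a b a') (h3 : 0 < orient e a' b) : False := by
  by_cases hcross : 0 ≤ (c.1 - b.1) * (d.2 - e.2) - (c.2 - b.2) * (d.1 - e.1)
  · obtain ⟨z, hz⟩ := h.pent.exists_beyond hcross
    exact (h.not_beyond h1.le h2.le h3 (by positivity) z).2.1 hz
  obtain ⟨x, hx⟩ : ∃ x : ℤ × ℤ, x = (e.1 + a.1 - a'.1, e.2 + a.2 - a'.2) := ⟨_, rfl⟩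
  obtain ⟨y, hy⟩ : ∃ y : ℤ × ℤ, y = (b.1 + a.1 - a'.1, b.2 + a.2 - a'.2) := ⟨_, rfl⟩
  have hor : 0 < orient d e x ∨ 0 < orient b c y := by
    by_contra! hneg
    have hde := orient_pos_rotate h.pent.bde
    have hbc := h.pent.bce
    have key : (orient e a a' + orient a b a') *
        -((c.1 - b.1) * (d.2 - e.2) - (c.2 - b.2) * (d.1 - e.1)) =
        orient d e b * orient b c y + orient b c e * orient d e x := by
      rw [hx, hy]; simp only [orient]; ring
    have hl := mul_pos (add_pos h1 h2) (neg_pos.2 (not_le.1 hcross))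
    have hr1 := mul_nonpos_of_nonneg_of_nonpos hde.le hneg.2
    have hr2 := mul_nonpos_of_nonneg_of_nonpos hbc.le hneg.1
    linarith
  rcases hor with hpos | hpos
  · have H := h.pent.rotate.rotate.rotate.rotate.insert (z := x) hpos
      (h1.trans_eq (by rw [hx]; simp only [orient]; ring))
      ((add_pos h1 h3).trans_eq (by rw [hx]; simp only [orient]; ring))
    have hj : PentJoined (fivePts a b c d e) (fivePts b c d e x) := H.joined
      (by simp [fivePts_rotate e a b c d])
      (by simp [fivePts_rotate x b c d e, fivePts_rotate e x b c d])
    refine h.bad (hj.trans (h.min H.rotate.rotate.rotate.pent ?_))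
    have : area a b c d e = area b c d e x + orient e a' b := by
      rw [hx]; simp only [area, orient]; ring
    omega
  · have H := h.pent.insert (z := y)
      ((add_pos h2 h3).trans_eq (by rw [hy]; simp only [orient]; ring))
      (h2.trans_eq (by rw [hy]; simp only [orient]; ring)) hpos
    have hj : PentJoined (fivePts a b c d e) (fivePts y b c d e) := H.joined (by simp) (by simp)
    refine h.bad (hj.trans (h.min H.rotate.pent ?_))
    have : area a b c d e = area y b c d e + orient e a' b := by
      rw [hy]; simp only [area, orient]; ring
    omega

/-- If the edge `ab` of a bad pentagon of least area has an interior lattice point, then no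
lattice point lies beyond one of the other edges. -/
theorem MinBad.not_beyond_of_edge {a b c d e : ℤ × ℤ} (h : MinBad a b c d e) {k : ℤ}
    {f : ℤ × ℤ} (hk : 2 ≤ k) (hb : b = (a.1 + k * f.1, a.2 + k * f.2)) (z : ℤ × ℤ) :
    ¬ Beyond a b c d z ∧ ¬ Beyond b c d e z ∧ ¬ Beyond c d e a z ∧ ¬ Beyond d e a b z := by
  have hk0 : 0 < k := by omega
  have hk1 : 0 < k - 1 := by omega
  have hA := orient_pos_rotate' h.pent.abe
  have hB := h.pent.abc
  have hab : ∀ t, orient a b (a.1 + t * f.1, a.2 + t * f.2) = 0 := fun t => by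
    rw [hb]; simp only [orient]; ring
  have h1 : 0 < orient e a (a.1 + 1 * f.1, a.2 + 1 * f.2) :=
    pos_of_mul_eq hk0 (by rw [hb]; simp only [orient]; ring) hA
  have h2 : 0 < orient e (a.1 + 1 * f.1, a.2 + 1 * f.2) b :=
    pos_of_mul_eq hk0 (by rw [hb]; simp only [orient]; ring) (mul_pos hk1 hA)
  have h3 : 0 < orient b c (a.1 + (k - 1) * f.1, a.2 + (k - 1) * f.2) :=
    pos_of_mul_eq hk0 (by rw [hb]; simp only [orient]; ring) hB
  have h4 : 0 < orient a (a.1 + (k - 1) * f.1, a.2 + (k - 1) * f.2) c :=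
    pos_of_mul_eq hk0 (by rw [hb]; simp only [orient]; ring) (mul_pos hk1 hB)
  have h5 := h.not_beyond h1.le (hab _).ge h2 (by rw [hab]; omega) z
  have h6 := h.rotate.not_beyond (hab _).ge h3.le h4 (by rw [hab]; omega) z
  exact ⟨h5.1, h5.2.1, h5.2.2, h6.2.2⟩

theorem MinBad.height_eq_one_of_lt {k : ℤ} {c d e : ℤ × ℤ} (h : MinBad (0, 0) (k, 0) c d e)
    (hk : 2 ≤ k) (h0 : 0 ≤ e.1) (h1 : e.1 < e.2) : e.2 = 1 := by
  by_contra hne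
  have he : 2 ≤ e.2 := by omega
  obtain ⟨c1, c2⟩ := c
  obtain ⟨d1, d2⟩ := d
  obtain ⟨e1, e2⟩ := e
  dsimp only at *
  by_cases hex : k = 2 ∧ e2 = 2 ∧ e1 = 0
  · obtain ⟨rfl, rfl, rfl⟩ := hex
    have hc := h.pent.abc
    have hd := h.pent.ade
    have n1 := (h.rotate.rotate.rotate.rotate.not_beyond_of_edge (k := 2) (f := (0, -1)) le_rfl
      (by simp) (1, -1)).1
    have n2 := (h.not_beyond_of_edge (k := 2) (f := (1, 0)) le_rfl (by simp) (-1, 1)).2.2.2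
    have n3 := fun z => (h.not_beyond_of_edge (k := 2) (f := (1, 0)) le_rfl (by simp) z).2.1
    simp only [Beyond, orient] at hc hd n1 n2
    ring_nf at hc hd n1 n2
    have m1 : c2 ≤ c1 - 2 := by omega
    have m2 : d1 ≤ d2 - 2 := by omega
    obtain ⟨z, hz⟩ := h.pent.exists_beyond (by
      have := mul_le_mul m1 m2 (by omega) (by omega)
      simp only; linarith)
    exact n3 z hz
  · refine h.not_interior (a' := (1, 1)) ?_ ?_ ?_ <;> simp only [orient]
    · linarith
    · linarith
    · have : 0 < (k - 2) * (e2 - 2) + (k - 2) + (e2 - 2) + e1 := by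
        have := mul_nonneg (show 0 ≤ k - 2 by omega) (show 0 ≤ e2 - 2 by omega)
        omega
      linarith

theorem MinBad.height_eq_one {k : ℤ} {c d e : ℤ × ℤ} (h : MinBad (0, 0) (k, 0) c d e)
    (hk : 2 ≤ k) : e.2 = 1 := by
  have he : 0 < e.2 := by
    have := h.pent.abe
    simp only [orient] at this
    exact pos_of_mul_pos_right (a := k) (by linarith) (by omega)
  have h' := h.linear (p := 1) (q := -(e.1 / e.2)) (r := 0) (s := 1) (by norm_num)
  have := MinBad.height_eq_one_of_lt (k := k) (by simpa using h') hk
  dsimp only at this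
  have hm := Int.emod_nonneg e.1 he.ne'
  have hm' := Int.emod_lt_of_pos e.1 he
  have hd := Int.emod_add_mul_ediv e.1 e.2
  exact this (by linarith) (by linarith)

theorem MinBad.mirror {k : ℤ} {c d e : ℤ × ℤ} (h : MinBad (0, 0) (k, 0) c d e) :
    MinBad (0, 0) (k, 0) (k - e.1, e.2) (k - d.1, d.2) (k - c.1, c.2) := by
  simpa [neg_add_eq_sub] using h.reflect.rotate.rotate.rotate.translate (k, 0)

theorem MinBad.trapezoid_bounds {k p x y : ℤ}
    (h : MinBad (0, 0) (k, 0) (k + p, 1) (x, y) (0, 1)) (hk : 2 ≤ k) :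
    2 ≤ y ∧ 0 < x ∧ x < k + p ∧ x ≤ y - 1 ∧ p * (y - 1) < x := by
  have hx := h.pent.ade
  have hc := h.pent.ace
  have hd := h.pent.cde
  have n1 := fun z => (h.not_beyond_of_edge (k := k) (f := (1, 0)) hk (by simp) z).2.1
  have n2 := fun z => (h.not_beyond_of_edge (k := k) (f := (1, 0)) hk (by simp) z).2.2.1
  have b1 : p * (y - 1) < x := by
    by_contra hle
    obtain ⟨z, hz⟩ := h.pent.exists_beyond (by simp only; linarith)
    exact n1 z hz
  have b2 : x < k + p := by
    by_contra hle
    obtain ⟨z, hz⟩ := h.pent.rotate.exists_beyond (by simp only; linarith)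
    exact n2 z hz
  simp only [orient] at hx hc hd
  ring_nf at hx hc
  have hy : 2 ≤ y := by
    have : 0 < y - 1 := pos_of_mul_eq hc (by ring) hd
    omega
  refine ⟨hy, hx, b2, ?_, b1⟩
  by_contra hlt
  refine n2 (1, 2) ⟨?_, ?_, ?_⟩ <;> simp only [orient]
  · have := mul_nonneg (show 0 ≤ y - 2 by omega) (show 0 ≤ k + p - 1 by omega)
    linarith
  · linarith
  · norm_num

theorem MinBad.not_trapezoid {k p x y : ℤ}
    (h : MinBad (0, 0) (k, 0) (k + p, 1) (x, y) (0, 1)) (hk : 2 ≤ k) : False := by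
  obtain ⟨hy, hx, hxk, hxy, hp⟩ := h.trapezoid_bounds hk
  have h' := h.mirror.linear (p := 1) (q := p) (r := 0) (s := 1) (by norm_num)
  obtain ⟨-, hx', -, hxy', -⟩ := MinBad.trapezoid_bounds (k := k) (p := p) (x := k - x + p * y)
    (y := y) (by simpa using h') hk
  have hp0 : p ≤ 0 := by
    by_contra hpos
    have := mul_nonneg (show 0 ≤ p - 1 by omega) (show 0 ≤ y - 1 by omega)
    linarith
  rcases hy.lt_or_eq with hy | rfl
  · rcases hxy.lt_or_eq with hlt | heq
    · refine h.rotate.rotate.rotate.not_interior (a' := (1, 2)) ?_ ?_ ?_ <;> simp only [orient]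
      · have := mul_nonneg (show 0 ≤ y - 3 by omega) (show 0 ≤ k + p - 1 by omega)
        linarith
      · linarith
      · linarith
    · obtain rfl : y = x + 1 := by omega
      refine h.rotate.rotate.rotate.not_interior (a' := (2, 2)) ?_ ?_ ?_ <;> simp only [orient]
      · have := mul_nonneg (show 0 ≤ x - 2 by omega) (show 0 ≤ k + p - 3 by omega)
        linarith
      · linarith
      · linarith
  · obtain rfl : x = 1 := by omega
    obtain rfl : k = 2 - 2 * p := by omega
    rcases hp0.lt_or_eq with hp0 | rfl
    · have hP := h.rotate.pent.replace (a' := (2 - 2 * p - 1, 0))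
        (by simp [orient]) (by simp [orient]) (by simp only [orient]; linarith)
      have hP' := hP.rotate.rotate.rotate.rotate
      have H := h.pent.insert (z := (1, -1)) (by simp [orient])
        (by simp only [orient]; linarith) (by simp only [orient]; linarith)
      have H' := hP'.insert (z := (1, -1)) (by simp [orient])
        (by simp only [orient]; linarith) (by simp only [orient]; linarith)
      refine h.bad (((H.joined (by simp) (by simp)).trans (H'.joined (S := fivePts (0, 0) (1, -1)
        (2 - 2 * p + p, 1) (1, 2) (0, 1)) (by simp) (by simp))).trans (h.min hP' ?_))
      simp only [area, orient]; linarith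
    · exact h.bad house_joined

theorem MinBad.not_horizontal_edge {k : ℤ} {c d e : ℤ × ℤ}
    (h : MinBad (0, 0) (k, 0) c d e) (hk : 2 ≤ k) : False := by
  have he := h.height_eq_one hk
  have hc : c.2 = 1 := h.mirror.height_eq_one hk
  have h' := h.linear (p := 1) (q := -e.1) (r := 0) (s := 1) (by norm_num)
  refine MinBad.not_trapezoid (k := k) (p := c.1 - e.1 - k) (x := d.1 - e.1 * d.2) (y := d.2) ?_ hk
  simpa [he, hc, ← sub_eq_add_neg] using h'

/-- The edges of a bad pentagon of least area have no interior lattice points. -/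
theorem MinBad.not_edge {a b c d e : ℤ × ℤ} (h : MinBad a b c d e) {k : ℤ} {f : ℤ × ℤ}
    (hk : 2 ≤ k) (hf : IsCoprime f.1 f.2) (hb : b = (a.1 + k * f.1, a.2 + k * f.2)) : False := by
  obtain ⟨u, v, huv⟩ := hf
  have h' := (h.translate (-a)).linear (p := u) (q := v) (r := -f.2) (s := f.1)
    (by linear_combination huv)
  rw [hb] at h'
  simp only [Prod.fst_add, Prod.snd_add, Prod.fst_neg, Prod.snd_neg, add_neg_cancel,
    Prod.fst_zero, Prod.snd_zero, mul_zero, add_zero, add_neg_cancel_comm] at h'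
  rw [show u * (k * f.1) + v * (k * f.2) = k by linear_combination k * huv,
    show -f.2 * (k * f.1) + f.1 * (k * f.2) = 0 by ring] at h'
  exact h'.not_horizontal_edge hk

theorem MinBad.isCoprime {a b c d e : ℤ × ℤ} (h : MinBad a b c d e) :
    IsCoprime (b.1 - a.1) (b.2 - a.2) := by
  have hg : 0 < Int.gcd (b.1 - a.1) (b.2 - a.2) := by
    refine Nat.pos_of_ne_zero fun h0 => ?_
    have := h.pent.abc
    simp [orient, (Int.gcd_eq_zero_iff.1 h0).1, (Int.gcd_eq_zero_iff.1 h0).2] at this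
  obtain ⟨f1, f2, hf, h1, h2⟩ := Int.exists_gcd_one hg
  rw [Int.isCoprime_iff_gcd_eq_one]
  by_contra hne
  refine h.not_edge (k := Int.gcd (b.1 - a.1) (b.2 - a.2)) (f := (f1, f2)) (by omega)
    (Int.isCoprime_iff_gcd_eq_one.2 hf) ?_
  ext <;> simp only <;> linarith

theorem MinBad.orient_dvd {a b c d e : ℤ × ℤ} (h : MinBad a b c d e) :
    orient e a b ∣ b.1 - e.1 ∧ orient e a b ∣ b.2 - e.2 := by
  obtain ⟨u, v, huv⟩ := h.rotate.rotate.rotate.rotate.isCoprime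
  obtain ⟨D, hD⟩ : ∃ D, D = orient e a b := ⟨_, rfl⟩
  have hpos : 0 < D := hD ▸ orient_pos_rotate' h.pent.abe
  obtain ⟨t, ht⟩ : ∃ t, t = ((b.1 - a.1) * u + (b.2 - a.2) * v) / D := ⟨_, rfl⟩
  obtain ⟨y1, hy1⟩ : ∃ y, y = -v + t * (a.1 - e.1) := ⟨_, rfl⟩
  obtain ⟨y2, hy2⟩ : ∃ y, y = u + t * (a.2 - e.2) := ⟨_, rfl⟩
  obtain ⟨m, hm⟩ : ∃ m, m = ((b.1 - a.1) * u + (b.2 - a.2) * v) % D := ⟨_, rfl⟩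
  have hm0 : 0 ≤ m := hm ▸ Int.emod_nonneg _ hpos.ne'
  have hmD : m < D := hm ▸ Int.emod_lt_of_pos _ hpos
  have hmt : m = (b.1 - a.1) * u + (b.2 - a.2) * v - D * t := by
    have := Int.emod_add_mul_ediv ((b.1 - a.1) * u + (b.2 - a.2) * v) D
    rw [← hm, ← ht] at this
    linarith
  rw [← hD]
  have hD' : D = (a.1 - e.1) * (b.2 - e.2) - (a.2 - e.2) * (b.1 - e.1) := hD
  have e1 : b.1 - a.1 = m * (a.1 - e.1) + D * y1 := by
    rw [hmt, hy1, hD']; linear_combination (-(b.1 - a.1)) * huv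
  have e2 : b.2 - a.2 = m * (a.2 - e.2) + D * y2 := by
    rw [hmt, hy2, hD']; linear_combination (-(b.2 - a.2)) * huv
  have hwy : (a.1 - e.1) * y2 - (a.2 - e.2) * y1 = 1 := by
    rw [hy1, hy2]; linear_combination huv
  have hby : (b.1 - a.1) * y2 - (b.2 - a.2) * y1 = m := by
    rw [e1, e2]; linear_combination m * hwy
  rcases hm0.eq_or_lt with rfl | hm0
  · have hc := h.isCoprime
    rw [e1, e2, zero_mul, zero_mul, zero_add, zero_add] at hc
    have hu : IsUnit D := hc.isUnit_of_dvd' (dvd_mul_right _ _) (dvd_mul_right _ _)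
    exact ⟨hu.dvd, hu.dvd⟩
  · rcases (Int.add_one_le_iff.2 hmD).eq_or_lt with hmD | hmD
    · exact ⟨⟨a.1 - e.1 + y1, by linear_combination e1 + (a.1 - e.1) * hmD⟩,
        ⟨a.2 - e.2 + y2, by linear_combination e2 + (a.2 - e.2) * hmD⟩⟩
    · refine (h.not_interior (a' := (a.1 + y1, a.2 + y2)) ?_ ?_ ?_).elim <;> simp only [orient]
      · linarith
      · linarith
      · linarith

theorem mul_lt_of_dvd_sub {g l s c M δ : ℤ} (hs : g < s) (hδ : δ = c + c * s * M - s * (l * g - 1))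
    (hdvd : δ ∣ s - g) (hc : 0 < c) (hg : 0 < g) : c * M < l * g := by
  have := Int.le_of_dvd (by omega) hdvd
  refine lt_of_mul_lt_mul_left (a := s) ?_ (by omega)
  linarith

theorem eq_one_of_le {g l n s c M δ η : ℤ} (hl : 0 < l) (hn : 0 < n) (hg : 0 < g) (hgs : g ≤ s)
    (hgc : g ≤ c) (hM : M = l * n * g - l - n) (hM1 : 0 < M) (hlg : 2 ≤ l * g) (hng : 2 ≤ n * g)
    (hδ : δ = c + c * s * M - s * (l * g - 1)) (hη : η = s + s * c * M - c * (n * g - 1))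
    (hδs : δ ∣ s - g) (hδl : δ ∣ l * g - 1) (hηc : η ∣ c - g) (hηn : η ∣ n * g - 1) :
    g = 1 := by
  by_contra hne
  have hg2 : 2 ≤ g := by omega
  have hM2 : l * (n - 1) + n * (l - 1) ≤ M := by
    have := mul_le_mul_of_nonneg_left hg2 (mul_pos hl hn).le
    linarith
  have key : ∀ {l n s c M δ : ℤ}, 0 < l → 0 < n → g ≤ s → g < c → M = l * n * g - l - n →
      0 < M → l * (n - 1) + n * (l - 1) ≤ M → δ ∣ c - g → δ = s + s * c * M - c * (n * g - 1) →
      l = 1 ∧ g = 2 := fun {l n s c M δ} hl hn hgs hgc hM hM1 hM2 hd hδ => by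
    have h1 := mul_lt_of_dvd_sub hgc hδ hd (by omega) hg
    have h2 : M < n := by
      have := mul_le_mul_of_nonneg_right hgs hM1.le
      exact lt_of_mul_lt_mul_left (a := g) (by linarith) hg.le
    have hl1 : l = 1 := by
      by_contra hl1
      have := mul_nonneg hn.le (show 0 ≤ l - 2 by omega)
      have := mul_nonneg hl.le (show 0 ≤ n - 1 by omega)
      linarith
    refine ⟨hl1, ?_⟩
    subst hl1
    by_contra hg3
    have := mul_nonneg (show 0 ≤ n - 1 by omega) (show 0 ≤ g - 3 by omega)
    linarith
  rcases hgs.eq_or_lt with rfl | hgs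
  · rcases hgc.eq_or_lt with rfl | hgc
    · have : g ∣ 1 := by
        have h1 : g ∣ l * g - 1 := dvd_trans ⟨1 + g * M - (l * g - 1), by rw [hδ]; ring⟩ hδl
        have := dvd_sub (dvd_mul_left g l) h1
        rwa [sub_sub_cancel] at this
      exact hne (Int.eq_one_of_dvd_one hg.le this)
    · obtain ⟨rfl, rfl⟩ := key hl hn le_rfl hgc hM hM1 hM2 hηc hη
      have h1 := Int.le_of_dvd (by norm_num) hδl
      have h2 := mul_le_mul_of_nonneg_right (show 3 ≤ c by omega) hM1.le
      linarith
  · rcases hgc.eq_or_lt with rfl | hgc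
    · obtain ⟨rfl, rfl⟩ := key hn hl le_rfl hgs (by linarith) hM1 (by linarith) hδs
        (by rw [hδ])
      have h1 := Int.le_of_dvd (by norm_num) hηn
      have h2 := mul_le_mul_of_nonneg_right (show 3 ≤ s by omega) hM1.le
      linarith
    · obtain ⟨h1, h2⟩ := key hl hn hgs.le hgc hM hM1 hM2 hηc hη
      obtain ⟨h3, -⟩ := key hn hl hgc.le hgs (by linarith) hM1 (by linarith) hδs (by rw [hδ])
      subst h1 h2 h3
      omega

theorem eq_three_of_eq_one {l n c M δ η : ℤ} (hc : 0 < c) (hM : M = l * n - l - n)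
    (hl : 2 ≤ l) (hn : 2 ≤ n) (hδ0 : 0 < δ) (hη0 : 0 < η)
    (hδ : δ = c + c * M - (l - 1)) (hη : η = 1 + c * M - c * (n - 1))
    (hδl : δ ∣ l - 1) (hηc : η ∣ c - 1) (hηn : η ∣ n - 1) :
    l = 3 ∧ (n = 2 ∧ c = 2 ∨ n = 3 ∧ c = 1) := by
  have h1 := Int.le_of_dvd (by omega) hδl
  have h2 : c * (n - 1) ≤ 2 := by
    refine le_of_mul_le_mul_right (a := l - 1) ?_ (by omega)
    rw [hδ, hM] at h1
    linarith
  have hc2 : c ≤ 2 := by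
    have := mul_nonneg hc.le (show 0 ≤ n - 2 by omega)
    linarith
  have hn3 : n ≤ 3 := by
    have := mul_nonneg (show 0 ≤ c - 1 by omega) (show 0 ≤ n - 1 by omega)
    linarith
  obtain rfl | rfl : c = 1 ∨ c = 2 := by omega
  · obtain rfl | rfl : n = 2 ∨ n = 3 := by omega
    · omega
    · have := Int.le_of_dvd (by norm_num) hηn
      omega
  · obtain rfl : n = 2 := by omega
    have := Int.le_of_dvd (by norm_num) hηn
    omega

theorem eq_of_eq_one {l n s c M δ η : ℤ} (hs : 0 < s) (hc : 0 < c) (hM : M = l * n - l - n)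
    (hM1 : 0 < M) (hl : 2 ≤ l) (hn : 2 ≤ n) (hδ0 : 0 < δ) (hη0 : 0 < η)
    (hδ : δ = c + c * s * M - s * (l - 1)) (hη : η = s + s * c * M - c * (n - 1))
    (hδs : δ ∣ s - 1) (hδl : δ ∣ l - 1) (hηc : η ∣ c - 1) (hηn : η ∣ n - 1) :
    l = 3 ∧ s = 1 ∧ n = 2 ∧ c = 2 ∨ l = 3 ∧ s = 1 ∧ n = 3 ∧ c = 1 ∨
      l = 2 ∧ s = 2 ∧ n = 3 ∧ c = 1 := by
  rcases (Int.add_one_le_iff.2 hs).eq_or_lt with h | hs1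
  · obtain rfl : s = 1 := by omega
    have := eq_three_of_eq_one hc hM hl hn hδ0 hη0 (by linarith) (by linarith) hδl hηc hηn
    omega
  rcases (Int.add_one_le_iff.2 hc).eq_or_lt with h | hc1
  · obtain rfl : c = 1 := by omega
    have := eq_three_of_eq_one (M := M) hs (by linarith) hn hl hη0 hδ0 (by linarith)
      (by linarith) hηn
      hδs hδl
    omega
  · have h1 := mul_lt_of_dvd_sub (g := 1) (l := l) (M := M) hs1 (by rw [hδ, mul_one]) hδs hc one_pos
    have h2 := mul_lt_of_dvd_sub (g := 1) (l := n) (M := M) hc1 (by rw [hη, mul_one]) hηc hs one_pos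
    have h3 := mul_le_mul_of_nonneg_right (show 2 ≤ c by omega) hM1.le
    have h4 := mul_le_mul_of_nonneg_right (show 2 ≤ s by omega) hM1.le
    have h5 := mul_le_mul (show 2 * M ≤ l - 1 by linarith) (show 2 * M ≤ n - 1 by linarith)
      (by omega) (by omega)
    have h6 := mul_nonneg hM1.le (show 0 ≤ M - 1 by omega)
    linarith

theorem steep_joined :
    ∀ S ∈ [fivePts (0, 0) (1, 0) (3, 1) (4, 2) (1, 1), fivePts (0, 0) (1, 0) (3, 1) (3, 2) (1, 1),
      fivePts (0, 0) (1, 0) (4, 2) (3, 2) (1, 1)], PentJoined S basePent := by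
  have H : Hex (0, 0) (1, 0) (3, 1) (4, 2) (3, 2) (1, 1) := by decide
  intro S hS
  refine (H.joined ?_ ?_).trans basePent_joined_shear
  · simp only [List.mem_cons, List.not_mem_nil, or_false] at hS ⊢
    tauto
  · decide

theorem MinBad.not_normal {g l n s t : ℤ}
    (h : MinBad (0, 0) (1, 0) (s * l, s) (t * n, t * (n * g - 1)) (1, g)) (hg : 0 < g)
    (hs : g ≤ s) (ht : g ≤ t) : False := by
  have hs0 : 0 < s := by omega
  have ht0 : 0 < t := by omega
  have hace := h.pent.ace
  have habd := h.pent.abd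
  have hacd := h.pent.acd
  have hcde := h.pent.cde
  have hbcd := h.pent.bcd
  have d1 := h.rotate.rotate.rotate.orient_dvd
  have d2 := h.rotate.rotate.orient_dvd
  simp only [orient] at hace habd hacd hcde hbcd d1 d2
  have hlg : 0 < l * g - 1 := pos_of_mul_eq hs0 (by ring) hace
  have hng : 0 < n * g - 1 := pos_of_mul_eq ht0 (by ring) habd
  have hl : 0 < l := pos_of_mul_pos_left (by linarith : 0 < l * g) hg.le
  have hn : 0 < n := pos_of_mul_pos_left (by linarith : 0 < n * g) hg.le
  obtain ⟨M, hM⟩ : ∃ M, M = l * n * g - l - n := ⟨_, rfl⟩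
  have hM1 : 0 < M := by
    refine pos_of_mul_eq (mul_pos hs0 ht0) ?_ hacd
    rw [hM]; ring
  obtain ⟨δ, hδ⟩ : ∃ δ, δ = t + t * s * M - s * (l * g - 1) := ⟨_, rfl⟩
  obtain ⟨η, hη⟩ : ∃ η, η = s + s * t * M - t * (n * g - 1) := ⟨_, rfl⟩
  have eδ : (t * n - s * l) * (g - s) - (t * (n * g - 1) - s) * (1 - s * l) = δ := by
    rw [hδ, hM]; ring
  have eη : (s * l - 1) * (t * (n * g - 1) - 0) - (s - 0) * (t * n - 1) = η := by
    rw [hη, hM]; ring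
  rw [eδ] at hcde d1
  rw [eη] at hbcd d2
  have hδs : δ ∣ s - g := by rw [← neg_sub]; exact d1.2.neg_right
  have hδl : δ ∣ l * g - 1 := by
    have := dvd_sub (d1.2.mul_left l) d1.1
    rwa [show l * (g - s) - (1 - s * l) = l * g - 1 by ring] at this
  have hηt : η ∣ t - g := by
    have := dvd_sub (d2.1.mul_left g) d2.2
    rwa [show g * (t * n - 1) - (t * (n * g - 1) - 0) = t - g by ring] at this
  have hηn : η ∣ n * g - 1 := by
    have := dvd_sub d2.1 (hηt.mul_left n)
    rwa [show t * n - 1 - n * (t - g) = n * g - 1 by ring] at this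
  obtain rfl := eq_one_of_le hl hn hg hs ht hM hM1 (by omega) (by omega) hδ hη hδs hδl hηt hηn
  simp only [mul_one] at *
  obtain ⟨rfl, rfl, rfl, rfl⟩ | ⟨rfl, rfl, rfl, rfl⟩ | ⟨rfl, rfl, rfl, rfl⟩ :=
    eq_of_eq_one hs0 ht0 hM hM1 (by omega) (by omega) hcde hbcd hδ hη hδs hδl hηt hηn
  all_goals exact h.bad (steep_joined _ (by simp))

theorem MinBad.false_of_horizontal {g : ℤ} {c d : ℤ × ℤ}
    (h : MinBad (0, 0) (1, 0) c d (1, g))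
    (h1 : orient (1, g) (0, 0) (1, 0) ≤ orient (0, 0) (1, 0) c)
    (h2 : orient (1, g) (0, 0) (1, 0) ≤ orient d (1, g) (0, 0)) : False := by
  have hg := h.pent.abe
  obtain ⟨c1, c2⟩ := c
  obtain ⟨d1, d2⟩ := d
  obtain ⟨l, hl⟩ := h.rotate.orient_dvd.1
  obtain ⟨n, hn⟩ := h.rotate.rotate.rotate.rotate.orient_dvd.1
  simp only [orient] at hl hn h1 h2 hg
  obtain ⟨t, ht⟩ : ∃ t, t = d1 * g - d2 := ⟨_, rfl⟩
  obtain rfl : c1 = c2 * l := by linarith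
  have hn' : d1 = t * -n := by rw [ht]; linarith
  obtain rfl : d2 = t * (-n * g - 1) := by rw [mul_sub, ← mul_assoc, ← hn']; linarith
  subst hn'
  exact h.not_normal (by linarith) (by linarith) (by linarith)

theorem MinBad.false_of_ear_le {a b c d e : ℤ × ℤ} (h : MinBad a b c d e)
    (h1 : orient e a b ≤ orient a b c) (h2 : orient e a b ≤ orient d e a) : False := by
  obtain ⟨⟨f1, hf1⟩, ⟨f2, hf2⟩⟩ := h.orient_dvd
  have hpos := orient_pos_rotate' h.pent.abe
  obtain ⟨g, hg⟩ : ∃ g, g = orient e a b := ⟨_, rfl⟩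
  rw [← hg] at hf1 hf2 hpos
  have hdet : f2 * (-(b.1 - a.1)) - (-f1) * (b.2 - a.2) = 1 := by
    refine mul_left_cancel₀ hpos.ne' ?_
    have : g = (a.1 - e.1) * (b.2 - e.2) - (a.2 - e.2) * (b.1 - e.1) := hg
    rw [mul_one]
    nth_rw 2 [this]
    linear_combination (b.1 - a.1) * hf2 - (b.2 - a.2) * hf1
  have h' := (h.translate (-a)).linear (p := -f2) (q := f1) (r := -(b.2 - a.2)) (s := b.1 - a.1)
    (by linear_combination hdet)
  have hor : ∀ x y z : ℤ × ℤ, orient x y z = orient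
      (-f2 * (x + -a).1 + f1 * (x + -a).2, -(b.2 - a.2) * (x + -a).1 + (b.1 - a.1) * (x + -a).2)
      (-f2 * (y + -a).1 + f1 * (y + -a).2, -(b.2 - a.2) * (y + -a).1 + (b.1 - a.1) * (y + -a).2)
      (-f2 * (z + -a).1 + f1 * (z + -a).2, -(b.2 - a.2) * (z + -a).1 + (b.1 - a.1) * (z + -a).2) :=
    fun x y z => by
      simp only [orient, Prod.fst_add, Prod.snd_add, Prod.fst_neg, Prod.snd_neg]
      linear_combination (-((y.1 - x.1) * (z.2 - x.2) - (y.2 - x.2) * (z.1 - x.1))) * hdet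
  rw [hor e a b, hor a b c] at h1
  rw [hor e a b, hor d e a] at h2
  simp only [add_neg_cancel, Prod.fst_zero, Prod.snd_zero, mul_zero, add_zero] at h' h1 h2
  rw [show (-f2 * (b + -a).1 + f1 * (b + -a).2,
    -(b.2 - a.2) * (b + -a).1 + (b.1 - a.1) * (b + -a).2) = ((1, 0) : ℤ × ℤ) from by
      ext <;> simp only [Prod.fst_add, Prod.snd_add, Prod.fst_neg, Prod.snd_neg]
      · linear_combination hdet
      · ring] at h' h1 h2
  rw [show (-f2 * (e + -a).1 + f1 * (e + -a).2,
    -(b.2 - a.2) * (e + -a).1 + (b.1 - a.1) * (e + -a).2) = ((1, g) : ℤ × ℤ) from by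
      ext <;> simp only [Prod.fst_add, Prod.snd_add, Prod.fst_neg, Prod.snd_neg]
      · linear_combination hdet + f2 * hf1 - f1 * hf2
      · linear_combination (b.2 - a.2) * hf1 - (b.1 - a.1) * hf2 + g * hdet] at h' h1 h2
  exact h'.false_of_horizontal h1 h2

theorem MinBad.elim {a b c d e : ℤ × ℤ} (h : MinBad a b c d e) : False := by
  have h1 := not_and.2 h.false_of_ear_le
  have h2 := not_and.2 h.rotate.false_of_ear_le
  have h3 := not_and.2 h.rotate.rotate.false_of_ear_le
  have h4 := not_and.2 h.rotate.rotate.rotate.false_of_ear_le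
  have h5 := not_and.2 h.rotate.rotate.rotate.rotate.false_of_ear_le
  omega

theorem area_pos {a b c d e : ℤ × ℤ} (h : Pent a b c d e) : 0 < area a b c d e :=
  add_pos (add_pos h.abc h.acd) h.ade

/-- Every lattice pentagon is joined to `basePent`. -/
theorem Pent.joined_basePent {a b c d e : ℤ × ℤ} (h : Pent a b c d e) :
    PentJoined (fivePts a b c d e) basePent := by
  obtain ⟨n, hn⟩ : ∃ n : ℕ, n = (area a b c d e).toNat := ⟨_, rfl⟩
  induction n using Nat.strong_induction_on generalizing a b c d e with
  | _ n ih =>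
    by_contra hbad
    refine MinBad.elim ⟨h, hbad, fun {a' b' c' d' e'} h' hlt => ih _ ?_ h' rfl⟩
    have := area_pos h'
    omega

/-- The embedding of the lattice `ℤ × ℤ` in the plane. -/
def latticePt (p : ℤ × ℤ) : Pt 2 := ![(p.1 : ℝ), (p.2 : ℝ)]

theorem latticePt_injective : Function.Injective latticePt := by
  intro p q h
  have h0 := congrFun h 0
  have h1 := congrFun h 1
  simp only [latticePt, Matrix.cons_val_zero, Matrix.cons_val_one, Int.cast_inj] at h0 h1
  exact Prod.ext h0 h1

theorem mem_range_latticePt {x : Pt 2} (h : IsLatticePt 2 x) : x ∈ range latticePt := by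
  obtain ⟨m, hm⟩ := h 0
  obtain ⟨n, hn⟩ := h 1
  refine ⟨(m, n), ?_⟩
  ext i
  fin_cases i <;> simp [latticePt, hm, hn]

theorem isLatticePt_latticePt (p : ℤ × ℤ) : IsLatticePt 2 (latticePt p) := by
  intro i
  fin_cases i
  · exact ⟨p.1, rfl⟩
  · exact ⟨p.2, rfl⟩

/-- The convex hull of a finite set of lattice points. -/
def latticeHull (S : Finset (ℤ × ℤ)) : Set (Pt 2) := convexHull ℝ (latticePt '' S)

theorem latticeHull_mono {S T : Finset (ℤ × ℤ)} (h : S ⊆ T) : latticeHull S ⊆ latticeHull T :=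
  convexHull_mono (image_mono (Finset.coe_subset.2 h))

/-- No point of `S` lies in the convex hull of the other points of `S`. -/
def InConvexPosition (S : Finset (ℤ × ℤ)) : Prop :=
  ∀ s ∈ S, latticePt s ∉ latticeHull (S.erase s)

theorem InConvexPosition.mono {S T : Finset (ℤ × ℤ)} (hS : InConvexPosition S) (h : T ⊆ S) :
    InConvexPosition T :=
  fun t ht hmem => hS t (h ht) (latticeHull_mono (Finset.erase_subset_erase t h) hmem)

theorem convexHull_extremePoints_convexHull {E : Type*} [NormedAddCommGroup E] [NormedSpace ℝ E]
    {s : Set E} (hs : s.Finite) :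
    convexHull ℝ ((convexHull ℝ s).extremePoints ℝ) = convexHull ℝ s := by
  have hfin := hs.subset (extremePoints_convexHull_subset (𝕜 := ℝ))
  rw [← (hfin.isClosed_convexHull ℝ).closure_eq]
  exact closure_convexHull_extremePoints (hs.isCompact_convexHull ℝ) (convex_convexHull ℝ s)

theorem InConvexPosition.extremePoints {S : Finset (ℤ × ℤ)} (hS : InConvexPosition S) :
    (latticeHull S).extremePoints ℝ = latticePt '' S := by
  refine extremePoints_convexHull_subset.antisymm ?_
  rintro _ ⟨s, hs, rfl⟩
  by_contra hmem
  have hsub : (latticeHull S).extremePoints ℝ ⊆ latticePt '' (S.erase s : Finset (ℤ × ℤ)) := by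
    intro x hx
    obtain ⟨t, ht, rfl⟩ := extremePoints_convexHull_subset hx
    refine ⟨t, Finset.mem_coe.2 (Finset.mem_erase.2 ⟨?_, ht⟩), rfl⟩
    rintro rfl
    exact hmem hx
  refine hS s hs (convexHull_mono hsub ?_)
  rw [latticeHull, convexHull_extremePoints_convexHull (S.finite_toSet.image _)]
  exact subset_convexHull ℝ _ (mem_image_of_mem _ hs)

theorem InConvexPosition.nVerts {S : Finset (ℤ × ℤ)} (hS : InConvexPosition S) :
    nVerts 2 (latticeHull S) = S.card := by
  rw [_root_.nVerts, hS.extremePoints, ncard_image_of_injective _ latticePt_injective,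
    ncard_coe_finset]

/-- A lattice polytope is the convex hull of a finite set of lattice points in convex position. -/
theorem exists_latticeHull_eq {P : Set (Pt 2)} (hP : IsPolytope 2 P) (hL : IsLatticePoly 2 P) :
    ∃ S, InConvexPosition S ∧ P = latticeHull S := by
  obtain ⟨F, rfl⟩ := hP
  have hfin := F.finite_toSet.subset (extremePoints_convexHull_subset (𝕜 := ℝ))
  have hpre := hfin.preimage (f := latticePt) latticePt_injective.injOn
  have himage : latticePt '' (hpre.toFinset : Set (ℤ × ℤ)) =
      (convexHull ℝ (F : Set (Pt 2))).extremePoints ℝ := by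
    rw [hpre.coe_toFinset, image_preimage_eq_of_subset fun x hx => mem_range_latticePt (hL x hx)]
  refine ⟨hpre.toFinset, fun s hs => ?_, ?_⟩
  · have hind := convexIndependent_set_iff_notMem_convexHull_sdiff.1
      (convex_convexHull ℝ (F : Set (Pt 2))).convexIndependent_extremePoints
    rw [latticeHull, Finset.coe_erase, image_sdiff latticePt_injective, himage, image_singleton]
    exact hind _ (by rw [← himage]; exact mem_image_of_mem _ hs)
  · rw [latticeHull, himage, convexHull_extremePoints_convexHull F.finite_toSet]

theorem notMem_latticeHull_of_orient_neg {S : Finset (ℤ × ℤ)} {p q r : ℤ × ℤ}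
    (hS : ∀ s ∈ S, 0 ≤ orient p q s) (hr : orient p q r < 0) : latticePt r ∉ latticeHull S := by
  set f : Pt 2 → ℝ := fun x => (q.1 - p.1) * x 1 - (q.2 - p.2) * x 0 with hf
  have hlin : IsLinearMap ℝ f := by
    constructor <;> intros <;> simp only [hf, Pi.add_apply, Pi.smul_apply, smul_eq_mul] <;> ring
  have hval : ∀ s, f (latticePt s) = f (latticePt p) + orient p q s := by
    intro s
    simp only [hf, latticePt, orient, Matrix.cons_val_zero, Matrix.cons_val_one]
    push_cast
    ring
  have hsub : latticeHull S ⊆ {x | f (latticePt p) ≤ f x} := by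
    refine convexHull_min ?_ (convex_halfSpace_ge hlin _)
    rintro _ ⟨s, hs, rfl⟩
    have : (0 : ℝ) ≤ orient p q s := by exact_mod_cast hS s hs
    simp only [mem_ofPred_eq, hval s]
    linarith
  intro hmem
  have h1 : f (latticePt p) ≤ f (latticePt r) := hsub hmem
  have h2 : (orient p q r : ℝ) < 0 := by exact_mod_cast hr
  rw [hval r] at h1
  linarith

/-- A lattice point that is a weighted mean of three points of `S` lies in their hull. -/
theorem mem_latticeHull_of_weights {S : Finset (ℤ × ℤ)} {p q r s : ℤ × ℤ} (hp : p ∈ S) (hq : q ∈ S)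
    (hr : r ∈ S) {x y z : ℤ} (hx : 0 ≤ x) (hy : 0 ≤ y) (hz : 0 ≤ z) (hD : 0 < x + y + z)
    (h : (x + y + z) • s = x • p + y • q + z • r) : latticePt s ∈ latticeHull S := by
  have hmem : ∀ t ∈ S, latticePt t ∈ latticeHull S := fun t ht =>
    subset_convexHull ℝ _ (mem_image_of_mem _ ht)
  have hD' : (0 : ℝ) < x + y + z := by exact_mod_cast hD
  have key : latticePt s = ((x : ℝ) / (x + y + z)) • latticePt p +
      ((y : ℝ) / (x + y + z)) • latticePt q + ((z : ℝ) / (x + y + z)) • latticePt r := by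
    have h0 := congrArg (fun t : ℤ × ℤ => (t.1 : ℝ)) h
    have h1 := congrArg (fun t : ℤ × ℤ => (t.2 : ℝ)) h
    simp only [Prod.smul_fst, Prod.smul_snd, Prod.fst_add, Prod.snd_add, smul_eq_mul,
      Int.cast_add, Int.cast_mul] at h0 h1
    ext i
    fin_cases i
    · simp only [latticePt, Pi.add_apply, Pi.smul_apply, smul_eq_mul, Fin.zero_eta,
        Matrix.cons_val_zero]
      field_simp
      linarith
    · simp only [latticePt, Pi.add_apply, Pi.smul_apply, smul_eq_mul, Fin.mk_one,
        Matrix.cons_val_one, Matrix.cons_val_fin_one]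
      field_simp
      linarith
  have hconv : Convex ℝ (latticeHull S) := convex_convexHull ℝ _
  have := hconv.sum_mem (t := Finset.univ)
    (w := ![(x : ℝ) / (x + y + z), (y : ℝ) / (x + y + z), (z : ℝ) / (x + y + z)])
    (z := ![latticePt p, latticePt q, latticePt r]) ?_ ?_ ?_
  · simpa [Fin.sum_univ_three, key] using this
  · have hx' : (0 : ℝ) ≤ x := by exact_mod_cast hx
    have hy' : (0 : ℝ) ≤ y := by exact_mod_cast hy
    have hz' : (0 : ℝ) ≤ z := by exact_mod_cast hz
    intro i _
    fin_cases i <;> simp <;> positivity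
  · simp [Fin.sum_univ_three]
    field_simp
  · intro i _
    fin_cases i <;> simp [hmem, hp, hq, hr]

theorem mem_latticeHull_of_collinear {S : Finset (ℤ × ℤ)} {v p q : ℤ × ℤ} (hv : v ∈ S) (hq : q ∈ S)
    (hvp : toLex v < toLex p) (hpq : toLex p < toLex q) (h : orient v p q = 0) :
    latticePt p ∈ latticeHull S := by
  rw [Prod.Lex.toLex_lt_toLex] at hvp hpq
  simp only [orient] at h
  rcases lt_or_ge v.1 q.1 with hlt | hge
  · refine mem_latticeHull_of_weights hq hv hv (x := p.1 - v.1) (y := q.1 - p.1) (z := 0)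
      (by omega) (by omega) le_rfl (by omega) ?_
    ext <;> simp only [Prod.smul_fst, Prod.smul_snd, Prod.fst_add, Prod.snd_add, smul_eq_mul] <;>
      linarith
  · have h1 : p.1 = v.1 := by omega
    have h2 : q.1 = v.1 := by omega
    refine mem_latticeHull_of_weights hq hv hv (x := p.2 - v.2) (y := q.2 - p.2) (z := 0)
      (by omega) (by omega) le_rfl (by omega) ?_
    ext <;> simp only [Prod.smul_fst, Prod.smul_snd, Prod.fst_add, Prod.snd_add, smul_eq_mul, h1,
      h2] <;> ring

theorem InConvexPosition.orient_ne_zero {S : Finset (ℤ × ℤ)} (hS : InConvexPosition S)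
    {v p q : ℤ × ℤ} (hv : v ∈ S) (hp : p ∈ S) (hq : q ∈ S) (hvp : toLex v < toLex p)
    (hpq : toLex p < toLex q) : orient v p q ≠ 0 := by
  intro h
  refine hS p hp (mem_latticeHull_of_collinear (Finset.mem_erase.2 ⟨?_, hv⟩)
    (Finset.mem_erase.2 ⟨?_, hq⟩) hvp hpq h)
  · rintro rfl; exact hvp.false
  · rintro rfl; exact hpq.false

theorem orient_comm (p q r : ℤ × ℤ) : orient p r q = -orient p q r := by
  simp only [orient]; ring

theorem InConvexPosition.orient_pos_or {S : Finset (ℤ × ℤ)} (hS : InConvexPosition S)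
    {v p q : ℤ × ℤ} (hv : v ∈ S) (hp : p ∈ S) (hq : q ∈ S) (hvp : toLex v < toLex p)
    (hvq : toLex v < toLex q) (hpq : p ≠ q) : 0 < orient v p q ∨ 0 < orient v q p := by
  have hne : orient v p q ≠ 0 := by
    rcases lt_or_gt_of_ne (toLex.injective.ne hpq) with h | h
    · exact hS.orient_ne_zero hv hp hq hvp h
    · have := hS.orient_ne_zero hv hq hp hvq h
      rw [orient_comm] at this
      exact neg_ne_zero.1 this
  rw [orient_comm v p q]
  omega

theorem orient_pos_trans {v p q r : ℤ × ℤ} (hp : toLex v < toLex p) (hq : toLex v < toLex q)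
    (hr : toLex v < toLex r) (hpq : 0 < orient v p q) (hqr : 0 < orient v q r) :
    0 < orient v p r := by
  rw [Prod.Lex.toLex_lt_toLex] at hp hq hr
  have key : (q.1 - v.1) * orient v p r =
      (p.1 - v.1) * orient v q r + (r.1 - v.1) * orient v p q := by
    simp only [orient]; ring
  have hp0 : 0 ≤ p.1 - v.1 := by omega
  have hq0 : 0 ≤ q.1 - v.1 := by omega
  have hr0 : 0 ≤ r.1 - v.1 := by omega
  have hp1 : 0 < p.1 - v.1 := by
    by_contra hle
    have h1 : p.1 = v.1 := by omega
    have h2 : 0 < p.2 - v.2 := by omega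
    simp only [orient, h1] at hpq
    nlinarith
  have hq1 : 0 < q.1 - v.1 := by
    by_contra hle
    have h1 : q.1 = v.1 := by omega
    have h2 : 0 < q.2 - v.2 := by omega
    simp only [orient, h1] at hqr
    nlinarith
  have : 0 < (q.1 - v.1) * orient v p r := by rw [key]; positivity
  exact pos_of_mul_pos_right this hq0

/-- In a finite transitive tournament some element dominates all the others. -/
theorem Finset.exists_dominating {α : Type*} [DecidableEq α] (R : α → α → Prop) {T : Finset α}
    (hT : T.Nonempty) (htot : ∀ p ∈ T, ∀ q ∈ T, p ≠ q → R p q ∨ R q p)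
    (htrans : ∀ p ∈ T, ∀ q ∈ T, ∀ r ∈ T, R p q → R q r → R p r) :
    ∃ m ∈ T, ∀ q ∈ T.erase m, R m q := by
  induction hT using Finset.Nonempty.cons_induction with
  | singleton a => exact ⟨a, Finset.mem_singleton_self a, by simp⟩
  | cons a s ha hs ih =>
    simp only [Finset.mem_cons] at htot htrans
    obtain ⟨m, hm, hdom⟩ := ih (fun p hp q hq => htot p (.inr hp) q (.inr hq))
      fun p hp q hq r hr => htrans p (.inr hp) q (.inr hq) r (.inr hr)
    have hne : a ≠ m := by rintro rfl; exact ha hm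
    simp only [Finset.mem_erase, Finset.mem_cons] at hdom ⊢
    rcases htot a (.inl rfl) m (.inr hm) hne with h | h
    · refine ⟨a, .inl rfl, ?_⟩
      rintro q ⟨hqa, rfl | hq⟩
      · exact absurd rfl hqa
      · by_cases hqm : q = m
        · rwa [hqm]
        · exact htrans a (.inl rfl) m (.inr hm) q (.inr hq) h (hdom q ⟨hqm, hq⟩)
    · refine ⟨m, .inr hm, ?_⟩
      rintro q ⟨hqm, rfl | hq⟩
      · exact h
      · exact hdom q ⟨hqm, hq⟩

/-- Points of a set in convex position seen in counterclockwise order from one of its points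
turn to the left. -/
theorem InConvexPosition.orient_pos {S : Finset (ℤ × ℤ)} (hS : InConvexPosition S)
    {v p q r : ℤ × ℤ} (hv : v ∈ S) (hp : p ∈ S) (hq : q ∈ S) (hr : r ∈ S)
    (hpq : 0 < orient v p q) (hqr : 0 < orient v q r) : 0 < orient p q r := by
  by_contra hle
  have hvq : v ≠ q := by rintro rfl; simp [orient] at hqr
  have hpq' : p ≠ q := by rintro rfl; simp [orient, mul_comm] at hpq
  have hrq : r ≠ q := by rintro rfl; simp [orient, mul_comm] at hqr
  refine hS q hq (mem_latticeHull_of_weights (Finset.mem_erase.2 ⟨hpq', hp⟩)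
    (Finset.mem_erase.2 ⟨hvq, hv⟩) (Finset.mem_erase.2 ⟨hrq, hr⟩) (x := orient v q r)
    (y := -orient p q r) (z := orient v p q) hqr.le (by omega) hpq.le (by omega) ?_)
  ext <;> simp only [orient, Prod.smul_fst, Prod.smul_snd, Prod.fst_add, Prod.snd_add,
    smul_eq_mul] <;> ring

/-- Five points in convex position are the vertices of a convex pentagon. -/
theorem InConvexPosition.exists_pent {S : Finset (ℤ × ℤ)} (hS : InConvexPosition S)
    (hcard : S.card = 5) : ∃ a b c d e, Pent a b c d e ∧ S = fivePts a b c d e := by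
  obtain ⟨v, hv, hmin⟩ := S.exists_min_image toLex (Finset.card_pos.1 (by omega))
  have hlt : ∀ p ∈ S.erase v, toLex v < toLex p := fun p hp =>
    lt_of_le_of_ne (hmin p (Finset.mem_of_mem_erase hp))
      (toLex.injective.ne (Finset.ne_of_mem_erase hp).symm)
  have hdom : ∀ T ⊆ S.erase v, T.Nonempty → ∃ m ∈ T, ∀ q ∈ T.erase m, 0 < orient v m q := by
    intro T hT hne
    refine Finset.exists_dominating (fun p q => 0 < orient v p q) hne ?_ ?_
    · intro p hp q hq
      exact hS.orient_pos_or hv (Finset.mem_of_mem_erase (hT hp))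
        (Finset.mem_of_mem_erase (hT hq)) (hlt p (hT hp)) (hlt q (hT hq))
    · intro p hp q hq r hr
      exact orient_pos_trans (hlt p (hT hp)) (hlt q (hT hq)) (hlt r (hT hr))
  have c1 : (S.erase v).card = 4 := by rw [Finset.card_erase_of_mem hv, hcard]
  obtain ⟨b, hb, hbdom⟩ := hdom (S.erase v) subset_rfl (Finset.card_pos.1 (by omega))
  have c2 : ((S.erase v).erase b).card = 3 := by rw [Finset.card_erase_of_mem hb, c1]
  obtain ⟨c, hc, hcdom⟩ := hdom ((S.erase v).erase b) (Finset.erase_subset _ _)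
    (Finset.card_pos.1 (by omega))
  have c3 : (((S.erase v).erase b).erase c).card = 2 := by rw [Finset.card_erase_of_mem hc, c2]
  obtain ⟨d, hd, hddom⟩ := hdom (((S.erase v).erase b).erase c)
    ((Finset.erase_subset _ _).trans (Finset.erase_subset _ _))
    (Finset.card_pos.1 (by omega))
  have c4 : ((((S.erase v).erase b).erase c).erase d).card = 1 := by
    rw [Finset.card_erase_of_mem hd, c3]
  obtain ⟨e, he⟩ := Finset.card_eq_one.1 c4
  have he' : e ∈ (((S.erase v).erase b).erase c).erase d := by
    rw [he]; exact Finset.mem_singleton_self e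
  have hS5 : S = fivePts v b c d e := by
    rw [fivePts, ← he, Finset.insert_erase hd, Finset.insert_erase hc, Finset.insert_erase hb,
      Finset.insert_erase hv]
  have bc := hbdom c hc
  have bd := hbdom d (Finset.mem_of_mem_erase hd)
  have be := hbdom e (Finset.mem_of_mem_erase (Finset.mem_of_mem_erase he'))
  have cd := hcdom d hd
  have ce := hcdom e (Finset.mem_of_mem_erase he')
  have de := hddom e he'
  simp only [Finset.mem_erase] at hb hc hd he'
  exact ⟨v, b, c, d, e, ⟨bc, bd, be, cd, ce, de, hS.orient_pos hv hb.2 hc.2.2 hd.2.2.2 bc cd,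
    hS.orient_pos hv hb.2 hc.2.2 he'.2.2.2.2 bc ce,
    hS.orient_pos hv hb.2 hd.2.2.2 he'.2.2.2.2 bd de,
    hS.orient_pos hv hc.2.2 hd.2.2.2 he'.2.2.2.2 cd de⟩, hS5⟩

theorem ne_of_orient_pos {p q r : ℤ × ℤ} (h : 0 < orient p q r) : p ≠ q := by
  rintro rfl
  simp [orient] at h

theorem Pent.card_fivePts {a b c d e : ℤ × ℤ} (h : Pent a b c d e) :
    (fivePts a b c d e).card = 5 := by
  have ab := ne_of_orient_pos h.abc
  have ac := ne_of_orient_pos h.acd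
  have ad := ne_of_orient_pos h.ade
  have ae := (ne_of_orient_pos (orient_pos_rotate' h.abe)).symm
  have bc := ne_of_orient_pos h.bcd
  have bd := ne_of_orient_pos h.bde
  have be := (ne_of_orient_pos (orient_pos_rotate' h.bce)).symm
  have cd := ne_of_orient_pos h.cde
  have ce := (ne_of_orient_pos (orient_pos_rotate' h.cde)).symm
  have de := ne_of_orient_pos (orient_pos_rotate h.cde)
  simp [fivePts, *]

/-- The set of the six given points. -/
def sixPts (a b c d e f : ℤ × ℤ) : Finset (ℤ × ℤ) := {a, b, c, d, e, f}

theorem sixPts_rotate (a b c d e f : ℤ × ℤ) : sixPts b c d e f a = sixPts a b c d e f := by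
  ext x; simp only [sixPts, Finset.mem_insert, Finset.mem_singleton]; tauto

theorem Hex.notMem_fivePts {a b c d e f : ℤ × ℤ} (h : Hex a b c d e f) :
    a ∉ fivePts b c d e f := by
  have ab := ne_of_orient_pos h.abf
  have ac := ne_of_orient_pos h.acf
  have ad := ne_of_orient_pos h.adf
  have ae := ne_of_orient_pos h.aef
  have af := (ne_of_orient_pos (orient_pos_rotate' h.abf)).symm
  simp [fivePts, *]

theorem Hex.erase_sixPts {a b c d e f : ℤ × ℤ} (h : Hex a b c d e f) :
    (sixPts a b c d e f).erase a = fivePts b c d e f :=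
  Finset.erase_insert h.notMem_fivePts

theorem Hex.card_sixPts {a b c d e f : ℤ × ℤ} (h : Hex a b c d e f) :
    (sixPts a b c d e f).card = 6 :=
  (Finset.card_insert_of_notMem h.notMem_fivePts).trans
    (congrArg (· + 1) h.rotate.pent.card_fivePts)

theorem orient_first_third (p q r : ℤ × ℤ) : orient r q p = -orient p q r := by
  simp only [orient]; ring

theorem Hex.notMem_latticeHull {a b c d e f : ℤ × ℤ} (h : Hex a b c d e f) :
    latticePt a ∉ latticeHull ((sixPts a b c d e f).erase a) := by
  rw [h.erase_sixPts]
  refine notMem_latticeHull_of_orient_neg (p := f) (q := b) (fun s hs => ?_) ?_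
  · simp only [fivePts, Finset.mem_insert, Finset.mem_singleton] at hs
    rcases hs with rfl | rfl | rfl | rfl | rfl
    · simp [orient, mul_comm]
    · exact (orient_pos_rotate' h.bcf).le
    · exact (orient_pos_rotate' h.bdf).le
    · exact (orient_pos_rotate' h.bef).le
    · simp [orient]
  · rw [orient_first_third]
    exact neg_neg_of_pos h.abf

theorem Hex.inConvexPosition {a b c d e f : ℤ × ℤ} (h : Hex a b c d e f) :
    InConvexPosition (sixPts a b c d e f) := by
  have hb := h.rotate.notMem_latticeHull
  have hc := h.rotate.rotate.notMem_latticeHull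
  have hd := h.rotate.rotate.rotate.notMem_latticeHull
  have he := h.rotate.rotate.rotate.rotate.notMem_latticeHull
  have hf := h.rotate.rotate.rotate.rotate.rotate.notMem_latticeHull
  rw [sixPts_rotate] at hb
  rw [sixPts_rotate, sixPts_rotate] at hc
  rw [sixPts_rotate, sixPts_rotate, sixPts_rotate] at hd
  rw [sixPts_rotate, sixPts_rotate, sixPts_rotate, sixPts_rotate] at he
  rw [sixPts_rotate, sixPts_rotate, sixPts_rotate, sixPts_rotate, sixPts_rotate] at hf
  intro s hs
  simp only [sixPts, Finset.mem_insert, Finset.mem_singleton] at hs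
  rcases hs with rfl | rfl | rfl | rfl | rfl | rfl
  exacts [h.notMem_latticeHull, hb, hc, hd, he, hf]

theorem fullDim_latticeHull {S : Finset (ℤ × ℤ)} {p q r : ℤ × ℤ} (hp : p ∈ S) (hq : q ∈ S)
    (hr : r ∈ S) (h : 0 < orient p q r) : FullDim 2 (latticeHull S) := by
  rw [FullDim, latticeHull, affineSpan_convexHull, eq_top_iff]
  have hmem : ∀ t ∈ S, latticePt t ∈ affineSpan ℝ (latticePt '' (S : Set (ℤ × ℤ))) :=
    fun t ht => subset_affineSpan ℝ _ (mem_image_of_mem _ ht)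
  have hD : (0 : ℝ) < (q.1 - p.1) * (r.2 - p.2) - (q.2 - p.2) * (r.1 - p.1) := by
    exact_mod_cast h
  set D : ℝ := (q.1 - p.1) * (r.2 - p.2) - (q.2 - p.2) * (r.1 - p.1) with hDdef
  intro x _
  have key := AffineSubspace.smul_vsub_vadd_mem _
    (((q.1 - p.1) * (x 1 - p.2) - (q.2 - p.2) * (x 0 - p.1)) / D) (hmem r hr) (hmem p hp)
    (AffineSubspace.smul_vsub_vadd_mem _
      (((r.2 - p.2) * (x 0 - p.1) - (r.1 - p.1) * (x 1 - p.2)) / D) (hmem q hq) (hmem p hp)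
      (hmem p hp))
  convert key using 1
  ext i
  fin_cases i
  · simp only [latticePt, vsub_eq_sub, vadd_eq_add, Pi.add_apply, Pi.smul_apply, Pi.sub_apply,
      smul_eq_mul, Fin.zero_eta, Matrix.cons_val_zero]
    field_simp
    rw [hDdef]
    ring
  · simp only [latticePt, vsub_eq_sub, vadd_eq_add, Pi.add_apply, Pi.smul_apply, Pi.sub_apply,
      smul_eq_mul, Fin.mk_one, Matrix.cons_val_one, Matrix.cons_val_fin_one]
    field_simp
    rw [hDdef]
    ring

theorem Pent.fullDim {a b c d e : ℤ × ℤ} (h : Pent a b c d e) {S : Finset (ℤ × ℤ)}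
    (hS : fivePts a b c d e ⊆ S) : FullDim 2 (latticeHull S) :=
  fullDim_latticeHull (hS (by simp [fivePts])) (hS (by simp [fivePts])) (hS (by simp [fivePts]))
    h.abc

/-- The lattice pentagons and the lattice hexagons. -/
def pentagonsHexagons : Set (Set (Pt 2)) := {P ∈ Lambda 2 | nVerts 2 P = 5 ∨ nVerts 2 P = 6}

theorem InConvexPosition.latticeHull_mem {S : Finset (ℤ × ℤ)} (hS : InConvexPosition S)
    (hdim : FullDim 2 (latticeHull S)) (hcard : S.card = 5 ∨ S.card = 6) :
    latticeHull S ∈ pentagonsHexagons := by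
  classical
  refine ⟨⟨⟨S.image latticePt, by rw [Finset.coe_image, latticeHull]⟩, hdim, ?_⟩,
    by rwa [hS.nVerts]⟩
  intro v hv
  rw [hS.extremePoints] at hv
  obtain ⟨s, -, rfl⟩ := hv
  exact isLatticePt_latticePt s

theorem InConvexPosition.move_erase {S : Finset (ℤ × ℤ)} (hS : InConvexPosition S) {v : ℤ × ℤ}
    (hv : v ∈ S) (hdim : FullDim 2 (latticeHull (S.erase v))) :
    Move 2 (latticeHull S) (latticeHull (S.erase v)) := by
  have hdiff : (latticeHull S).extremePoints ℝ \ {latticePt v} =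
      latticePt '' (S.erase v : Finset (ℤ × ℤ)) := by
    rw [hS.extremePoints, Finset.coe_erase, image_sdiff latticePt_injective, image_singleton]
  refine .inr (.inl ⟨latticePt v, ⟨?_, ?_⟩, ?_⟩)
  · rw [hS.extremePoints]
    exact mem_image_of_mem _ hv
  · rwa [hdiff]
  · rw [hdiff, latticeHull]

/-- Adjacency in the subgraph induced by the class `C`. -/
def StepIn (C : Set (Set (Pt 2))) (P Q : Set (Pt 2)) : Prop := P ∈ C ∧ Q ∈ C ∧ Move 2 P Q

theorem StepIn.symm {C : Set (Set (Pt 2))} {P Q : Set (Pt 2)} (h : StepIn C P Q) :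
    StepIn C Q P := by
  obtain ⟨hP, hQ, h⟩ := h
  refine ⟨hQ, hP, ?_⟩
  unfold Move at h ⊢
  tauto

theorem StepIn.reflTransGen_symm {C : Set (Set (Pt 2))} {P Q : Set (Pt 2)}
    (h : Relation.ReflTransGen (StepIn C) P Q) : Relation.ReflTransGen (StepIn C) Q P :=
  have : Std.Symm (StepIn C) := ⟨fun _ _ => StepIn.symm⟩
  Std.Symm.symm _ _ h

theorem exists_pathLE_of_reflTransGen {C : Set (Set (Pt 2))} {P Q : Set (Pt 2)} (hP : P ∈ C)
    (h : Relation.ReflTransGen (StepIn C) P Q) : ∃ n, PathLE 2 C P Q n := by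
  induction h with
  | refl => exact ⟨0, 0, fun _ => P, le_rfl, rfl, rfl, fun _ _ => hP, by simp⟩
  | @tail Q R _ hQR ih =>
    obtain ⟨n, m, f, -, h0, hm, hC, hmove⟩ := ih
    refine ⟨m + 1, m + 1, fun i => if i ≤ m then f i else R, le_rfl, by simp [h0], by simp, ?_, ?_⟩
    · intro i _
      dsimp only
      split_ifs with hi
      · exact hC i hi
      · exact hQR.2.1
    · intro i hi
      rcases (Nat.lt_succ_iff.1 hi).lt_or_eq with hlt | rfl
      · simpa [hlt.le, Nat.succ_le_of_lt hlt] using hmove i hlt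
      · simpa [hm] using hQR.2.2

theorem Hex.stepIn {a b c d e f : ℤ × ℤ} (h : Hex a b c d e f) :
    StepIn pentagonsHexagons (latticeHull (sixPts a b c d e f))
      (latticeHull (fivePts b c d e f)) := by
  have hsub : fivePts b c d e f ⊆ sixPts a b c d e f := Finset.subset_insert _ _
  have hS := h.inConvexPosition
  have hpent := h.rotate.pent
  refine ⟨hS.latticeHull_mem (hpent.fullDim hsub) (.inr h.card_sixPts),
    (hS.mono hsub).latticeHull_mem (hpent.fullDim subset_rfl) (.inl hpent.card_fivePts), ?_⟩
  have := hS.move_erase (v := a) (by simp [sixPts])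
  rw [h.erase_sixPts] at this
  exact this (hpent.fullDim subset_rfl)

theorem PentJoined.reflTransGen {S T : Finset (ℤ × ℤ)} (h : PentJoined S T) :
    Relation.ReflTransGen (StepIn pentagonsHexagons) (latticeHull S) (latticeHull T) := by
  induction h with
  | rel S T h =>
    obtain ⟨a, b, c, d, e, f, h, rfl, rfl⟩ := h
    have hlast := h.rotate.rotate.rotate.rotate.rotate.stepIn
    rw [sixPts_rotate, sixPts_rotate, sixPts_rotate, sixPts_rotate, sixPts_rotate] at hlast
    exact .head hlast.symm (.single h.stepIn)
  | refl S => exact .refl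
  | symm S T _ ih => exact StepIn.reflTransGen_symm ih
  | trans S T U _ _ ih₁ ih₂ => exact ih₁.trans ih₂

theorem reflTransGen_basePent {P : Set (Pt 2)} (hP : P ∈ pentagonsHexagons) :
    Relation.ReflTransGen (StepIn pentagonsHexagons) P (latticeHull basePent) := by
  obtain ⟨⟨hpoly, hdim, hlat⟩, hcard⟩ := id hP
  obtain ⟨S, hS, rfl⟩ := exists_latticeHull_eq hpoly hlat
  rw [hS.nVerts] at hcard
  rcases hcard with hcard | hcard
  · obtain ⟨a, b, c, d, e, h, rfl⟩ := hS.exists_pent hcard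
    exact h.joined_basePent.reflTransGen
  · obtain ⟨v, hv⟩ := Finset.card_pos.1 (by omega : 0 < S.card)
    have hS' := hS.mono (Finset.erase_subset v S)
    have hcard' : (S.erase v).card = 5 := by rw [Finset.card_erase_of_mem hv, hcard]
    obtain ⟨a, b, c, d, e, h, heq⟩ := hS'.exists_pent hcard'
    have hdim' := h.fullDim heq.ge
    refine .head ⟨hP, hS'.latticeHull_mem hdim' (.inl hcard'), hS.move_erase hv hdim'⟩ ?_
    rw [heq]
    exact h.joined_basePent.reflTransGen

/-- the subgraph induced in `Λ(2)` by the lattice pentagons and the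
lattice hexagons is connected. -/
theorem stmt_15 :
    ConnectedIn 2 {P ∈ Lambda 2 | nVerts 2 P = 5 ∨ nVerts 2 P = 6} := by
  intro P hP Q hQ
  exact exists_pathLE_of_reflTransGen hP ((reflTransGen_basePent hP).trans
    (StepIn.reflTransGen_symm (reflTransGen_basePent hQ)))
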